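/- arXiv:2010.11914 — 6 statements merged into one kernel-verified Lean document; each statement's English description precedes it below -/
import Mathlib

section
/- Let N be a finite set, L ⊆ A_N with |L| ≤ 2, and M ⊆ A_N. Suppose that for every principally regular symmetric matrix Γ with rational entries, rows and columns indexed by N, satisfying L ⊆ CIS(Γ), one has CIS(Γ) ∩ M ≠ ∅. Then for every gaussoid G over N with L ⊆ G, one has G ∩ M ≠ ∅. (In other words: gaussoids are a two-antecedental approximation of algebraic Gaussian CI structures over the rationals.) -/
open scoped symmDiff

abbrev CIStmt (N : Type*) := Sym2 N × Finset N

def CIStmt.proper {N : Type*} (s : CIStmt N) : Prop :=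
  ¬ s.1.IsDiag ∧ ∀ i ∈ s.1, i ∉ s.2

variable {N : Type*} [DecidableEq N]

def pminor {R : Type*} [CommRing R] (M : Matrix N N R) (S : Finset N) : R :=
  (M.submatrix (fun a : S => (a : N)) (fun a : S => (a : N))).det

def apminor {R : Type*} [CommRing R] (M : Matrix N N R) (i j : N) (K : Finset N) : R :=
  (Matrix.of fun a b : Unit ⊕ ↥K =>
      M (Sum.elim (fun _ => i) (fun k => (k : N)) a)
        (Sum.elim (fun _ => j) (fun k => (k : N)) b)).det

def PrinReg {R : Type*} [CommRing R] (M : Matrix N N R) : Prop :=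
  ∀ S : Finset N, pminor M S ≠ 0

def PosDefMinors {R : Type*} [Field R] [LinearOrder R] [IsStrictOrderedRing R] (M : Matrix N N R) : Prop :=
  ∀ S : Finset N, 0 < pminor M S

def CIS {R : Type*} [CommRing R] (M : Matrix N N R) : Set (CIStmt N) :=
  {s | s.proper ∧ ∀ i j : N, s.1 = s(i, j) → apminor M i j s.2 = 0}

def IsGaussoid (G : Set (CIStmt N)) : Prop :=
  (∀ s ∈ G, s.proper) ∧
  ∀ i j k : N, ∀ L : Finset N,
    i ≠ j → i ≠ k → j ≠ k → i ∉ L → j ∉ L → k ∉ L →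
      (((s(i,j), L) ∈ G ∧ (s(i,k), insert j L) ∈ G) ↔
        ((s(i,k), L) ∈ G ∧ (s(i,j), insert k L) ∈ G)) ∧
      (((s(i,j), insert k L) ∈ G ∧ (s(i,k), insert j L) ∈ G) ↔
        ((s(i,j), L) ∈ G ∧ (s(i,k), L) ∈ G)) ∧
      (((s(i,j), L) ∈ G ∧ (s(i,j), insert k L) ∈ G) →
        ((s(i,k), L) ∈ G ∨ (s(j,k), L) ∈ G))



lemma apminor_def {R : Type*} [CommRing R] (Γ : Matrix N N R) (a b : N) (C : Finset N) :
    apminor Γ a b C = Matrix.det (Matrix.of fun x y : Unit ⊕ ↥C =>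
      Γ (Sum.elim (fun _ => a) (fun k : ↥C => (k : N)) x)
        (Sum.elim (fun _ => b) (fun k : ↥C => (k : N)) y)) := by
  unfold apminor
  congr 1
  ext (x | x) (y | y) <;> rfl

lemma apminor_block {R : Type*} [CommRing R] (Γ : Matrix N N R) (a b : N) (C : Finset N)
    (h : ∀ r ∈ C, ∀ c ∈ C, Γ r c = if r = c then 1 else 0) :
    apminor Γ a b C = Γ a b - ∑ c ∈ C, Γ a c * Γ c b := by
  have : (Matrix.of fun x y : Unit ⊕ ↥C =>
      Γ (Sum.elim (fun _ => a) (fun k : ↥C => (k : N)) x)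
        (Sum.elim (fun _ => b) (fun k : ↥C => (k : N)) y)) =
      Matrix.fromBlocks (Matrix.of fun _ _ => Γ a b) (Matrix.of fun _ (c : ↥C) => Γ a c)
        (Matrix.of fun (r : ↥C) _ => Γ r b) 1 := by
    ext (x | x) (y | y) <;> simp
    rw [h _ x.2 _ y.2, Matrix.one_apply]
    by_cases hxy : x = y
    · rw [if_pos hxy, if_pos (congrArg _ hxy)]
    · rw [if_neg hxy, if_neg (fun h => hxy (Subtype.ext h))]
  rw [apminor_def, this, Matrix.det_fromBlocks_one₂₂, Matrix.det_unique]
  simp [Matrix.mul_apply]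
  exact Finset.sum_coe_sort C (fun c => Γ a c * Γ c b)

lemma apminor_empty {R : Type*} [CommRing R] (Γ : Matrix N N R) (a b : N) :
    apminor Γ a b ∅ = Γ a b := by
  rw [apminor_block]
  · simp
  · simp

lemma apminor_ne_of_ker (Γ : Matrix N N ℚ) (a b : N) (C : Finset N)
    (h : ∀ (w : ℚ) (v : N → ℚ), Γ a b * w + ∑ c ∈ C, Γ a c * v c = 0 →
      (∀ r ∈ C, Γ r b * w + ∑ c ∈ C, Γ r c * v c = 0) → w = 0 ∧ ∀ c ∈ C, v c = 0) :
    apminor Γ a b C ≠ 0 := by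
  intro h0
  rw [apminor_def, ← Matrix.exists_mulVec_eq_zero_iff] at h0
  obtain ⟨u, hu, hk⟩ := h0
  apply hu
  let v : N → ℚ := fun c => if hc : c ∈ C then u (Sum.inr ⟨c, hc⟩) else 0
  have hs : ∀ r, ∑ c ∈ C, Γ r c * v c = ∑ c : C, Γ r c * u (Sum.inr c) := by
    intro r
    rw [← Finset.sum_coe_sort C]
    exact Finset.sum_congr rfl fun c _ => by simp [v]
  have := h (u (Sum.inl ())) v ?_ ?_
  · ext (x | x)
    · exact this.1
    · have := this.2 x x.2
      simpa [v] using this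
  · rw [hs]
    have := congrFun hk (Sum.inl ())
    simpa [Matrix.mulVec, dotProduct] using this
  · intro r hr
    rw [hs]
    have := congrFun hk (Sum.inr ⟨r, hr⟩)
    simpa [Matrix.mulVec, dotProduct] using this

lemma apminor_zero_of_comb (Γ : Matrix N N ℚ) (a b : N) (C : Finset N) (y : N → ℚ)
    (h : ∀ c, (c ∈ C ∨ c = b) → Γ a c = ∑ m ∈ C, y m * Γ m c) :
    apminor Γ a b C = 0 := by
  rw [apminor_def, ← Matrix.exists_vecMul_eq_zero_iff]
  refine ⟨Sum.elim (fun _ => 1) (fun m => - y m), ?_, ?_⟩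
  · intro h0
    have := congrFun h0 (Sum.inl ())
    simp at this
  · ext (x | x)
    · simp only [Matrix.vecMul, dotProduct, Fintype.sum_sum_type]
      simp [h b (Or.inr rfl)]
      rw [← Finset.sum_coe_sort C]
      simp
    · simp only [Matrix.vecMul, dotProduct, Fintype.sum_sum_type]
      simp [h x (Or.inl x.2)]
      rw [← Finset.sum_coe_sort C]
      simp

lemma apminor_symm {R : Type*} [CommRing R] (Γ : Matrix N N R) (h : Γ.IsSymm) (a b : N)
    (C : Finset N) : apminor Γ b a C = apminor Γ a b C := by
  rw [apminor_def, ← Matrix.det_transpose, apminor_def]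
  congr 1
  ext x y
  simp [h.apply]

lemma mem_CIS_iff {R : Type*} [CommRing R] (Γ : Matrix N N R) (h : Γ.IsSymm) (a b : N)
    (C : Finset N) : ((s(a, b), C) : CIStmt N) ∈ CIS Γ ↔
      (a ≠ b ∧ a ∉ C ∧ b ∉ C) ∧ apminor Γ a b C = 0 := by
  constructor
  · rintro ⟨⟨h1, h2⟩, h3⟩
    refine ⟨⟨by simpa using h1, h2 a (by simp), h2 b (by simp)⟩, h3 a b rfl⟩
  · rintro ⟨⟨h1, h2, h3⟩, h4⟩
    refine ⟨⟨by simpa using h1, ?_⟩, ?_⟩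
    · simp [h2, h3]
    · intro i j hij
      simp only [Sym2.eq_iff] at hij
      rcases hij with ⟨rfl, rfl⟩ | ⟨rfl, rfl⟩
      · exact h4
      · rw [apminor_symm _ h]; exact h4

lemma map_pminor {R S : Type*} [CommRing R] [CommRing S] (f : R →+* S) (Γ : Matrix N N R)
    (K : Finset N) : pminor (Γ.map f) K = f (pminor Γ K) := by
  rw [pminor, pminor, RingHom.map_det]; rfl

lemma map_apminor {R S : Type*} [CommRing R] [CommRing S] (f : R →+* S) (Γ : Matrix N N R)
    (a b : N) (K : Finset N) : apminor (Γ.map f) a b K = f (apminor Γ a b K) := by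
  rw [apminor_def, apminor_def, RingHom.map_det]; rfl

lemma generic_point [Fintype N] {σ : Type*} (Γ : Matrix N N (MvPolynomial σ ℚ))
    (U : Set (CIStmt N))
    (h1 : ∃ x : σ → ℚ, Γ.map (MvPolynomial.eval x) = 1)
    (hU : ∀ a b C, a ≠ b → a ∉ C → b ∉ C → ((s(a, b), C) : CIStmt N) ∉ U →
      ∃ x : σ → ℚ, apminor (Γ.map (MvPolynomial.eval x)) a b C ≠ 0) :
    ∃ x : σ → ℚ, PrinReg (Γ.map (MvPolynomial.eval x)) ∧
      CIS (Γ.map (MvPolynomial.eval x)) ⊆ U := by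
  classical
  let P : MvPolynomial σ ℚ := (∏ S : Finset N, pminor Γ S) *
    ∏ t : N × N × Finset N, if (t.1 ≠ t.2.1 ∧ t.1 ∉ t.2.2 ∧ t.2.1 ∉ t.2.2 ∧
      ((s(t.1, t.2.1), t.2.2) : CIStmt N) ∉ U) then apminor Γ t.1 t.2.1 t.2.2 else 1
  have hP : P ≠ 0 := by
    refine mul_ne_zero (Finset.prod_ne_zero_iff.2 ?_) (Finset.prod_ne_zero_iff.2 ?_)
    · intro S _ h0
      obtain ⟨x, hx⟩ := h1
      have := map_pminor (MvPolynomial.eval x) Γ S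
      rw [hx, h0] at this
      simp [pminor, Matrix.submatrix_one _ Subtype.val_injective] at this
    · rintro ⟨a, b, C⟩ _
      split_ifs with h
      · obtain ⟨x, hx⟩ := hU a b C h.1 h.2.1 h.2.2.1 h.2.2.2
        rw [map_apminor] at hx
        intro h0
        simp only at h0
        rw [h0] at hx
        simp at hx
      · exact one_ne_zero
  obtain ⟨x, hx⟩ : ∃ x : σ → ℚ, MvPolynomial.eval x P ≠ 0 := by
    by_contra! hcon
    exact hP (MvPolynomial.funext fun x => by simpa using hcon x)
  rw [map_mul, mul_ne_zero_iff, map_prod, map_prod, Finset.prod_ne_zero_iff,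
    Finset.prod_ne_zero_iff] at hx
  refine ⟨x, fun S => ?_, ?_⟩
  · rw [map_pminor]; exact hx.1 S (Finset.mem_univ _)
  · rintro ⟨e, C⟩ hs
    induction e using Sym2.ind with
    | _ a b =>
    by_contra hc
    obtain ⟨⟨h1, h2⟩, h3⟩ := hs
    have h3 := h3 a b rfl
    rw [map_apminor] at h3
    have := hx.2 (a, b, C) (Finset.mem_univ _)
    rw [if_pos ⟨by simpa using h1, h2 a (by simp), h2 b (by simp), hc⟩] at this
    exact this h3

/-- Columns of `A` on `S`, columns of `B` elsewhere. -/
def mixM (A B : Matrix N N ℚ) (S : Finset N) : Matrix N N ℚ :=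
  Matrix.of fun r c => if c ∈ S then A r c else B r c

/-- Like `mixM`, but with column `j` of `A` placed in slot `i`. -/
def apmixM (A B : Matrix N N ℚ) (i j : N) (S : Finset N) : Matrix N N ℚ :=
  Matrix.of fun r c => if c = i then A r j else if c ∈ S then A r c else B r c

lemma pminor_eq_mix [Fintype N] (Γ : Matrix N N ℚ) (S : Finset N) :
    pminor Γ S = (mixM Γ 1 S).det := by
  rw [Matrix.twoBlockTriangular_det' _ (· ∈ S)]
  · have h2 : (Matrix.toSquareBlockProp (mixM Γ 1 S) fun i => ¬ i ∈ S) = 1 := by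
      ext ⟨x, hx⟩ ⟨y, hy⟩
      simp [Matrix.toSquareBlockProp, mixM, hy, Matrix.one_apply]
    have h3 : Matrix.toSquareBlockProp (mixM Γ 1 S) (· ∈ S) =
        Γ.submatrix (fun a : S => (a : N)) (fun a : S => (a : N)) := by
      ext ⟨x, hx⟩ ⟨y, hy⟩
      simp [Matrix.toSquareBlockProp, mixM, hy]
    rw [h2, Matrix.det_one, mul_one, pminor, h3]
    convert rfl
  · intro i hi j hj
    simp [mixM, hj, Matrix.one_apply]
    rintro rfl; exact absurd hi hj

lemma apminor_eq_mix [Fintype N] (Γ : Matrix N N ℚ) (i j : N) (S : Finset N) (hi : i ∉ S) :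
    apminor Γ i j S = (apmixM Γ 1 i j S).det := by
  rw [Matrix.twoBlockTriangular_det' _ (· ∈ insert i S)]
  · have h2 : (Matrix.toSquareBlockProp (apmixM Γ 1 i j S) fun x => ¬ x ∈ insert i S) = 1 := by
      ext ⟨x, hx⟩ ⟨y, hy⟩
      simp only [Finset.mem_insert, not_or] at hy
      simp [Matrix.toSquareBlockProp, apmixM, hy, Matrix.one_apply]
    rw [h2, Matrix.det_one, mul_one, apminor_def]
    let f : Unit ⊕ S → {x // x ∈ insert i S} :=
      Sum.elim (fun _ => ⟨i, by simp⟩) (fun k => ⟨k, by simp⟩)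
    have hf : Function.Bijective f := by
      constructor
      · rintro (x | x) (y | y) h
        · rfl
        · simp [f] at h; exact absurd (h ▸ y.2) hi
        · simp [f] at h; exact absurd (h ▸ x.2) hi
        · simp [f] at h; simp [h]
      · rintro ⟨x, hx⟩
        rcases Finset.mem_insert.1 hx with rfl | hx
        · exact ⟨Sum.inl (), rfl⟩
        · exact ⟨Sum.inr ⟨x, hx⟩, rfl⟩
    have h5 := Matrix.det_submatrix_equiv_self (Equiv.ofBijective f hf)
      (Matrix.toSquareBlockProp (apmixM Γ 1 i j S) (· ∈ insert i S))
    have h6 : (Matrix.toSquareBlockProp (apmixM Γ 1 i j S) (· ∈ insert i S)).submatrix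
        (Equiv.ofBijective f hf) (Equiv.ofBijective f hf) =
        (Matrix.of fun x y : Unit ⊕ ↥S =>
        Γ (Sum.elim (fun _ => i) (fun k : ↥S => (k : N)) x)
        (Sum.elim (fun _ => j) (fun k : ↥S => (k : N)) y)) := by
      ext (x | x) (y | y)
      · simp [f, Matrix.toSquareBlockProp, apmixM]
      · have : (y : N) ≠ i := by rintro h; exact hi (h ▸ y.2)
        simp [f, Matrix.toSquareBlockProp, apmixM, this]
      · simp [f, Matrix.toSquareBlockProp, apmixM]
      · have : (y : N) ≠ i := by rintro h; exact hi (h ▸ y.2)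
        simp [f, Matrix.toSquareBlockProp, apmixM, this]
    rw [h6] at h5
    convert h5
  · intro x hx y hy
    simp only [Finset.mem_insert, not_or] at hx hy
    simp [apmixM, hy, Matrix.one_apply]
    rintro rfl; exact absurd hx (by simp [hy])

lemma det_mix_ne_iff [Fintype N] (A B : Matrix N N ℚ) (v : N → ℚ) (hv : ∀ c, v c ≠ 0)
    (h : ∀ r c, A r c = v c * B r c) : A.det = 0 ↔ B.det = 0 := by
  have : A = Matrix.of fun r c => v c * B r c := by ext; simp [h]
  rw [this, Matrix.det_mul_row]
  simp [Finset.prod_eq_zero_iff, hv]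

lemma sweep [Fintype N] (Γ : Matrix N N ℚ) (hs : Γ.IsSymm) (hp : PrinReg Γ) (Z : Finset N) :
    ∃ Γ' : Matrix N N ℚ, Γ'.IsSymm ∧ PrinReg Γ' ∧ ∀ i j C, i ≠ j → i ∉ C → j ∉ C →
      (apminor Γ' i j C = 0 ↔ apminor Γ i j ((C ∆ Z) \ {i, j}) = 0) := by
  let A : Matrix N N ℚ := Matrix.of fun r c => if c ∈ Z then (1 : Matrix N N ℚ) r c else Γ r c
  let B : Matrix N N ℚ := Matrix.of fun r c => if c ∈ Z then - Γ r c else (1 : Matrix N N ℚ) r c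
  have hB : B.det ≠ 0 := by
    rw [Ne, det_mix_ne_iff B (mixM Γ 1 Z) (fun c => if c ∈ Z then -1 else 1),
      ← pminor_eq_mix]
    · exact hp Z
    · intro c; split_ifs <;> simp
    · intro r c; simp only [B, mixM, Matrix.of_apply]; split_ifs <;> simp
  have hBu : IsUnit B.det := isUnit_iff_ne_zero.2 hB
  have hBA : B * (B⁻¹ * A) = A := by rw [Matrix.mul_nonsing_inv_cancel_left _ _ hBu]
  have hAB : A * B.transpose = B * A.transpose := by
    have hAB : ∀ r c, (A * B.transpose) r c - (B * A.transpose) r c = 0 := by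
      intro r c
      have : (A * B.transpose) r c - (B * A.transpose) r c =
          (Γ * (1 : Matrix N N ℚ)) r c - ((1 : Matrix N N ℚ) * Γ) r c := by
        simp only [Matrix.mul_apply, ← Finset.sum_sub_distrib]
        refine Finset.sum_congr rfl fun x _ => ?_
        simp only [A, B, Matrix.transpose_apply, Matrix.of_apply]
        rw [← hs.apply x c, show (1 : Matrix N N ℚ) x c = (1 : Matrix N N ℚ) c x from by
          simp [Matrix.one_apply, eq_comm]]
        split_ifs <;> ring
      rw [this]; simp
    ext r c
    linarith [hAB r c]
  have key : ∀ (X Y : Matrix N N ℚ), B * X = Y → (X.det = 0 ↔ Y.det = 0) := by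
    rintro X Y rfl
    simp [Matrix.det_mul, hB]
  refine ⟨B⁻¹ * A, ?_, ?_, ?_⟩
  · rw [Matrix.IsSymm, Matrix.transpose_mul, Matrix.transpose_nonsing_inv]
    have hBt : IsUnit B.transpose.det := by rwa [Matrix.det_transpose]
    calc A.transpose * B.transpose⁻¹ = B⁻¹ * (B * A.transpose) * B.transpose⁻¹ := by
          rw [Matrix.nonsing_inv_mul_cancel_left _ _ hBu]
      _ = B⁻¹ * (A * B.transpose) * B.transpose⁻¹ := by rw [hAB]
      _ = B⁻¹ * A := by
          rw [← Matrix.mul_assoc, Matrix.mul_nonsing_inv_cancel_right _ _ hBt]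
  · intro S
    rw [pminor_eq_mix, Ne, key _ (mixM A B S),
      det_mix_ne_iff _ (mixM Γ 1 (S ∆ Z)) (fun c => if c ∈ Z ∧ c ∉ S then -1 else 1),
      ← pminor_eq_mix]
    · exact hp _
    · intro c; split_ifs <;> simp
    · intro r c
      simp only [A, B, mixM, Matrix.of_apply, Finset.mem_symmDiff]
      by_cases h1 : c ∈ Z <;> by_cases h2 : c ∈ S <;> simp [h1, h2]
    · ext r c
      have := congrFun (congrFun hBA r) c
      have h1 := congrFun (congrFun (Matrix.mul_one B) r) c
      simp only [Matrix.mul_apply, mixM, Matrix.of_apply] at this h1 ⊢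
      split_ifs with h
      · exact this
      · exact h1
  · intro i j C hij hi hj
    rw [apminor_eq_mix _ _ _ _ hi, apminor_eq_mix _ _ _ _ (by simp), key _ (apmixM A B i j C)]
    · by_cases hjZ : j ∈ Z
      · rw [← neg_eq_zero (a := (apmixM Γ 1 i j _).det), ← neg_one_mul]
        have hsw := Matrix.det_permute' (Equiv.swap i j)
          (apmixM Γ 1 i j ((C ∆ Z) \ {i, j}))
        rw [Equiv.Perm.sign_swap hij] at hsw
        push_cast at hsw
        rw [← hsw]
        refine det_mix_ne_iff _ _ (fun c => if c ≠ i ∧ c ∈ Z ∧ c ∉ C then -1 else 1) ?_ ?_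
        · intro c; split_ifs <;> simp
        · intro r c
          simp only [A, B, apmixM, Matrix.of_apply, Matrix.submatrix_apply, id]
          by_cases hci : c = i
          · subst hci
            rw [Equiv.swap_apply_left]
            simp [hjZ, hij.symm]
          · by_cases hcj : c = j
            · subst hcj
              simp [hjZ, hci, hj]
            · rw [Equiv.swap_apply_of_ne_of_ne hci hcj]
              by_cases h1 : c ∈ Z <;> by_cases h2 : c ∈ C <;>
                simp [h1, h2, hci, hcj, Finset.mem_symmDiff]
      · refine det_mix_ne_iff _ _ (fun c => if c ≠ i ∧ c ∈ Z ∧ c ∉ C then -1 else 1) ?_ ?_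
        · intro c; split_ifs <;> simp
        · intro r c
          simp only [A, B, apmixM, Matrix.of_apply]
          by_cases hci : c = i
          · subst hci
            simp [hjZ]
          · by_cases hcj : c = j
            · subst hcj
              simp [hjZ, hci, hj]
            · by_cases h1 : c ∈ Z <;> by_cases h2 : c ∈ C <;>
                simp [h1, h2, hci, hcj, Finset.mem_symmDiff]
    · ext r c
      have := fun c => congrFun (congrFun hBA r) c
      have h1 := congrFun (congrFun (Matrix.mul_one B) r) c
      simp only [Matrix.mul_apply, apmixM, Matrix.of_apply] at this h1 ⊢
      split_ifs with h h'
      · exact this j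
      · exact this c
      · exact h1

/-- The symmetrization of `x`, with the entries `ij` and `ji` set to zero. -/
def symX {R : Type*} [CommRing R] (i j : N) (x : N → N → R) : Matrix N N R :=
  Matrix.of fun r c => if (r = i ∧ c = j) ∨ (r = j ∧ c = i) then 0 else x r c + x c r

/-- Overwrite row and column `k` on `M ∪ {l}` by the combination of the rows in `M` with
coefficients `y`. -/
def phiM {R : Type*} [CommRing R] (k l : N) (M : Finset N) (X : Matrix N N R) (y : N → R) :
    Matrix N N R :=
  Matrix.of fun r c => if r = k ∧ (c ∈ M ∨ c = l) then ∑ m ∈ M, y m * X m c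
    else if c = k ∧ (r ∈ M ∨ r = l) then ∑ m ∈ M, y m * X m r else X r c

/-- A skew-symmetric matrix applied to column `j`. -/
def skewV {R : Type*} [CommRing R] (j : N) (M : Finset N) (X : Matrix N N R) (w : N → N → R) :
    N → R := fun p => ∑ q ∈ M, (w p q - w q p) * X q j

lemma symX_map {R S : Type*} [CommRing R] [CommRing S] (f : R →+* S) (i j : N) (x : N → N → R) :
    (symX i j x).map f = symX i j (fun a b => f (x a b)) := by
  ext r c
  simp only [symX, Matrix.map_apply, Matrix.of_apply]
  split_ifs <;> simp

lemma phiM_map {R S : Type*} [CommRing R] [CommRing S] (f : R →+* S) (k l : N) (M : Finset N)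
    (X : Matrix N N R) (y : N → R) :
    (phiM k l M X y).map f = phiM k l M (X.map f) (fun a => f (y a)) := by
  ext r c
  simp only [phiM, Matrix.map_apply, Matrix.of_apply]
  split_ifs <;> simp [map_sum]

lemma skewV_map {R S : Type*} [CommRing R] [CommRing S] (f : R →+* S) (j : N) (M : Finset N)
    (X : Matrix N N R) (w : N → N → R) (p : N) :
    f (skewV j M X w p) = skewV j M (X.map f) (fun a b => f (w a b)) p := by
  simp [skewV, map_sum]

lemma symX_symm {R : Type*} [CommRing R] (i j : N) (x : N → N → R) : (symX i j x).IsSymm := by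
  ext r c
  simp only [symX, Matrix.transpose_apply, Matrix.of_apply]
  by_cases h : (r = i ∧ c = j) ∨ (r = j ∧ c = i)
  · rw [if_pos h, if_pos (by tauto)]
  · rw [if_neg h, if_neg (by tauto), add_comm]

lemma symX_self (i j : N) (Γ : Matrix N N ℚ) (h : Γ.IsSymm) (h0 : Γ i j = 0) :
    symX i j (fun a b => Γ a b / 2) = Γ := by
  ext r c
  simp only [symX, Matrix.of_apply]
  split_ifs with h1
  · rcases h1 with ⟨rfl, rfl⟩ | ⟨rfl, rfl⟩
    · exact h0.symm
    · rw [h.apply]; exact h0.symm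
  · rw [h.apply r c]; ring

lemma phiM_symm {R : Type*} [CommRing R] (k l : N) (M : Finset N) (X : Matrix N N R) (y : N → R)
    (hX : X.IsSymm) (hkl : k ≠ l) (hk : k ∉ M) : (phiM k l M X y).IsSymm := by
  ext r c
  simp only [phiM, Matrix.transpose_apply, Matrix.of_apply]
  by_cases h1 : r = k ∧ (c ∈ M ∨ c = l)
  · by_cases h2 : c = k ∧ (r ∈ M ∨ r = l)
    · obtain ⟨rfl, _⟩ := h1
      obtain ⟨rfl, h | h⟩ := h2
      · exact absurd h hk
      · exact absurd h hkl
    · rw [if_neg h2, if_pos h1, if_pos h1]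
  · by_cases h2 : c = k ∧ (r ∈ M ∨ r = l)
    · rw [if_pos h2, if_neg h1, if_pos h2]
    · rw [if_neg h2, if_neg h1, if_neg h1, if_neg h2, hX.apply]

lemma phiM_self (k l : N) (M : Finset N) (Γ : Matrix N N ℚ) (hs : Γ.IsSymm) (y : N → ℚ)
    (h : ∀ c, (c ∈ M ∨ c = l) → Γ k c = ∑ m ∈ M, y m * Γ m c) :
    phiM k l M Γ y = Γ := by
  ext r c
  simp only [phiM, Matrix.of_apply]
  split_ifs with h1 h2
  · rw [h1.1, h c h1.2]
  · rw [h2.1, ← h r h2.2, hs.apply]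
  · rfl

lemma phiM_comb (k l : N) (M : Finset N) (X : Matrix N N ℚ) (y : N → ℚ)
    (hkl : k ≠ l) (hk : k ∉ M) : apminor (phiM k l M X y) k l M = 0 := by
  apply apminor_zero_of_comb _ _ _ _ y
  intro c hc
  simp only [phiM, Matrix.of_apply]
  rw [if_pos ⟨trivial, hc⟩]
  refine Finset.sum_congr rfl fun m hm => ?_
  rw [if_neg, if_neg]
  · rintro ⟨rfl, _⟩
    rcases hc with h | h
    · exact hk h
    · exact hkl h
  · rintro ⟨rfl, _⟩
    exact hk hm

lemma exists_A [Fintype N] (i j k l : N) (M : Finset N) (U : Set (CIStmt N))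
    (hij : i ≠ j) (hkl : k ≠ l) (hjk : j ≠ k) (hjl : j ≠ l) (hil : i ≠ l)
    (hkM : k ∉ M) (hlM : l ∉ M) (hiM : i ∉ M) (hjM : j ∉ M)
    (pts : ∀ a b C, a ≠ b → a ∉ C → b ∉ C → ((s(a, b), C) : CIStmt N) ∉ U →
      ∃ Γ : Matrix N N ℚ, Γ.IsSymm ∧ Γ i j = 0 ∧
        (∃ y : N → ℚ, ∀ c, (c ∈ M ∨ c = l) → Γ k c = ∑ m ∈ M, y m * Γ m c) ∧
        apminor Γ a b C ≠ 0) :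
    ∃ Γ : Matrix N N ℚ, Γ.IsSymm ∧ PrinReg Γ ∧ ((s(i, j), ∅) : CIStmt N) ∈ CIS Γ ∧
      ((s(k, l), M) : CIStmt N) ∈ CIS Γ ∧ CIS Γ ⊆ U := by
  let Γ0 : Matrix N N (MvPolynomial ((N × N) ⊕ N) ℚ) :=
    phiM k l M (symX i j (fun a b => MvPolynomial.X (Sum.inl (a, b))))
      (fun a => MvPolynomial.X (Sum.inr a))
  have hmap : ∀ z, Γ0.map (MvPolynomial.eval z) =
      phiM k l M (symX i j (fun a b => z (Sum.inl (a, b)))) (fun a => z (Sum.inr a)) := by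
    intro z
    simp only [Γ0, phiM_map, symX_map, MvPolynomial.eval_X]
  have himg : ∀ Γ : Matrix N N ℚ, Γ.IsSymm → Γ i j = 0 →
      (∃ y : N → ℚ, ∀ c, (c ∈ M ∨ c = l) → Γ k c = ∑ m ∈ M, y m * Γ m c) →
      ∃ z, Γ0.map (MvPolynomial.eval z) = Γ := by
    rintro Γ h1 h2 ⟨y, hy⟩
    refine ⟨Sum.elim (fun p => Γ p.1 p.2 / 2) y, ?_⟩
    rw [hmap]
    simp only [Sum.elim_inl, Sum.elim_inr]
    rw [symX_self i j Γ h1 h2, phiM_self k l M Γ h1 y hy]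
  obtain ⟨z, hz, hzU⟩ := generic_point Γ0 U
    (himg 1 Matrix.isSymm_one (by simp [hij]) ⟨0, fun c hc => by
      have : k ≠ c := by rintro rfl; tauto
      simp [this]⟩)
    (fun a b C h1 h2 h3 h4 => by
      obtain ⟨Γ, g1, g2, g3, g4⟩ := pts a b C h1 h2 h3 h4
      obtain ⟨z, hz⟩ := himg Γ g1 g2 g3
      exact ⟨z, by rwa [hz]⟩)
  rw [hmap] at hz hzU
  have hsy := phiM_symm k l M _ (fun a => z (Sum.inr a))
    (symX_symm i j (fun a b => z (Sum.inl (a, b)))) hkl hkM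
  refine ⟨_, hsy, hz, ?_, ?_, hzU⟩
  · rw [mem_CIS_iff _ hsy]
    refine ⟨⟨hij, by simp, by simp⟩, ?_⟩
    rw [apminor_empty]
    simp [phiM, hjM, hjl, hjk, symX]
  · rw [mem_CIS_iff _ hsy]
    exact ⟨⟨hkl, hkM, hlM⟩, phiM_comb k l M _ _ hkl hkM⟩

lemma skew_sum (M : Finset N) (w : N → N → ℚ) (z : N → ℚ) :
    ∑ m ∈ M, (∑ q ∈ M, (w m q - w q m) * z q) * z m = 0 := by
  have h : ∑ m ∈ M, (∑ q ∈ M, (w m q - w q m) * z q) * z m =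
      ∑ m ∈ M, ∑ q ∈ M, w m q * z q * z m - ∑ m ∈ M, ∑ q ∈ M, w q m * z q * z m := by
    rw [← Finset.sum_sub_distrib]
    refine Finset.sum_congr rfl fun m _ => ?_
    rw [← Finset.sum_sub_distrib, Finset.sum_mul]
    exact Finset.sum_congr rfl fun q _ => by ring
  rw [h, Finset.sum_comm (f := fun m q => w q m * z q * z m), sub_eq_zero]
  exact Finset.sum_congr rfl fun m _ => Finset.sum_congr rfl fun q _ => by ring

lemma exists_B [Fintype N] (i j : N) (M : Finset N) (U : Set (CIStmt N))
    (hij : i ≠ j) (hiM : i ∉ M) (hjM : j ∉ M)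
    (pts : ∀ a b C, a ≠ b → a ∉ C → b ∉ C → ((s(a, b), C) : CIStmt N) ∉ U →
      ∃ Γ : Matrix N N ℚ, Γ.IsSymm ∧ Γ i j = 0 ∧
        (∃ w : N → N → ℚ, ∀ c ∈ M, Γ i c = ∑ m ∈ M, skewV j M Γ w m * Γ m c) ∧
        apminor Γ a b C ≠ 0) :
    ∃ Γ : Matrix N N ℚ, Γ.IsSymm ∧ PrinReg Γ ∧ ((s(i, j), ∅) : CIStmt N) ∈ CIS Γ ∧
      ((s(i, j), M) : CIStmt N) ∈ CIS Γ ∧ CIS Γ ⊆ U := by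
  let X0 : Matrix N N (MvPolynomial ((N × N) ⊕ (N × N)) ℚ) :=
    symX i j (fun a b => MvPolynomial.X (Sum.inl (a, b)))
  let Γ0 := phiM i j M X0 (skewV j M X0 (fun a b => MvPolynomial.X (Sum.inr (a, b))))
  have hmap : ∀ z, Γ0.map (MvPolynomial.eval z) =
      phiM i j M (symX i j (fun a b => z (Sum.inl (a, b))))
        (skewV j M (symX i j (fun a b => z (Sum.inl (a, b)))) fun a b => z (Sum.inr (a, b))) := by
    intro z
    simp only [Γ0, X0, phiM_map, symX_map, MvPolynomial.eval_X, skewV_map]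
  have himg : ∀ Γ : Matrix N N ℚ, Γ.IsSymm → Γ i j = 0 →
      (∃ w : N → N → ℚ, ∀ c ∈ M, Γ i c = ∑ m ∈ M, skewV j M Γ w m * Γ m c) →
      ∃ z, Γ0.map (MvPolynomial.eval z) = Γ := by
    rintro Γ h1 h2 ⟨y, hy⟩
    refine ⟨Sum.elim (fun p => Γ p.1 p.2 / 2) (fun p => y p.1 p.2), ?_⟩
    rw [hmap]
    simp only [Sum.elim_inl, Sum.elim_inr]
    rw [symX_self i j Γ h1 h2, phiM_self i j M Γ h1]
    rintro c (hc | rfl)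
    · exact hy c hc
    · rw [h2]; exact (skew_sum M y (fun m => Γ m c)).symm
  obtain ⟨z, hz, hzU⟩ := generic_point Γ0 U
    (himg 1 Matrix.isSymm_one (by simp [hij]) ⟨0, fun c hc => by
      have : i ≠ c := by rintro rfl; tauto
      simp [this, skewV]⟩)
    (fun a b C h1 h2 h3 h4 => by
      obtain ⟨Γ, g1, g2, g3, g4⟩ := pts a b C h1 h2 h3 h4
      obtain ⟨z, hz⟩ := himg Γ g1 g2 g3
      exact ⟨z, by rwa [hz]⟩)
  rw [hmap] at hz hzU
  have hsy := phiM_symm i j M _ (skewV j M (symX i j (fun a b => z (Sum.inl (a, b))))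
    fun a b => z (Sum.inr (a, b))) (symX_symm i j (fun a b => z (Sum.inl (a, b)))) hij hiM
  refine ⟨_, hsy, hz, ?_, ?_, hzU⟩
  · rw [mem_CIS_iff _ hsy]
    refine ⟨⟨hij, by simp, by simp⟩, ?_⟩
    rw [apminor_empty]
    simp only [phiM, Matrix.of_apply]
    rw [if_pos ⟨trivial, Or.inr trivial⟩]
    exact skew_sum M _ (fun m => symX i j (fun a b => z (Sum.inl (a, b))) m j)
  · rw [mem_CIS_iff _ hsy]
    exact ⟨⟨hij, hiM, hjM⟩, phiM_comb i j M _ _ hij hiM⟩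

lemma exists_empty [Fintype N] (U : Set (CIStmt N))
    (pts : ∀ a b C, a ≠ b → a ∉ C → b ∉ C → ((s(a, b), C) : CIStmt N) ∉ U →
      ∃ Γ : Matrix N N ℚ, Γ.IsSymm ∧ apminor Γ a b C ≠ 0) :
    ∃ Γ : Matrix N N ℚ, Γ.IsSymm ∧ PrinReg Γ ∧ CIS Γ ⊆ U := by
  let Γ0 : Matrix N N (MvPolynomial (N × N) ℚ) :=
    Matrix.of fun r c => MvPolynomial.X (r, c) + MvPolynomial.X (c, r)
  have hmap : ∀ z, Γ0.map (MvPolynomial.eval z) = Matrix.of fun r c => z (r, c) + z (c, r) := by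
    intro z; ext r c; simp [Γ0]
  have himg : ∀ Γ : Matrix N N ℚ, Γ.IsSymm → ∃ z, Γ0.map (MvPolynomial.eval z) = Γ := by
    intro Γ h
    refine ⟨fun p => Γ p.1 p.2 / 2, ?_⟩
    rw [hmap]; ext r c
    simp only [Matrix.of_apply]
    rw [h.apply r c]; ring
  obtain ⟨z, hz, hzU⟩ := generic_point Γ0 U (himg 1 Matrix.isSymm_one)
    (fun a b C h1 h2 h3 h4 => by
      obtain ⟨Γ, g1, g4⟩ := pts a b C h1 h2 h3 h4
      obtain ⟨z, hz⟩ := himg Γ g1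
      exact ⟨z, by rwa [hz]⟩)
  refine ⟨_, ?_, hz, hzU⟩
  rw [hmap]; ext r c; simp [add_comm]

/-- Symmetric matrix of a single edge. -/
def Ed (a b : N) : Matrix N N ℚ :=
  Matrix.of fun r c => if (r = a ∧ c = b) ∨ (r = b ∧ c = a) then 1 else 0

lemma Ed_apply (a b r c : N) :
    Ed a b r c = if (r = a ∧ c = b) ∨ (r = b ∧ c = a) then 1 else 0 := rfl

lemma Ed_symm (a b : N) : (Ed a b).IsSymm := by
  ext r c
  simp only [Matrix.transpose_apply, Ed_apply]
  congr 1
  simp only [eq_iff_iff]; tauto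

/-- Coordinate vector. -/
def yv (m : N) : N → ℚ := fun x => if x = m then 1 else 0

lemma sum_yv (M : Finset N) (m : N) (hm : m ∈ M) (f : N → ℚ) :
    ∑ x ∈ M, yv m x * f x = f m := by
  simp [yv, hm]

lemma val1 (Γ : Matrix N N ℚ) (a b : N) (C : Finset N)
    (h : ∀ r ∈ C, ∀ c ∈ C, Γ r c = if r = c then 1 else 0)
    (h1 : ∀ c ∈ C, Γ a c * Γ c b = 0) (h2 : Γ a b ≠ 0) : apminor Γ a b C ≠ 0 := by
  rw [apminor_block _ _ _ _ h, Finset.sum_eq_zero h1, sub_zero]; exact h2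

lemma val2 (Γ : Matrix N N ℚ) (a b : N) (C : Finset N)
    (h : ∀ r ∈ C, ∀ c ∈ C, Γ r c = if r = c then 1 else 0) (c0 : N) (hc0 : c0 ∈ C)
    (h1 : ∀ c ∈ C, c ≠ c0 → Γ a c * Γ c b = 0) (h2 : Γ a b = 0) (h3 : Γ a c0 * Γ c0 b ≠ 0) :
    apminor Γ a b C ≠ 0 := by
  rw [apminor_block _ _ _ _ h, Finset.sum_eq_single_of_mem c0 hc0 h1, h2, zero_sub]
  simpa using h3

lemma edge_val (a b : N) (C : Finset N) (hab : a ≠ b) (ha : a ∉ C) (hb : b ∉ C) :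
    apminor (1 + Ed a b) a b C ≠ 0 := by
  apply val1
  · intro r hr c hc
    simp only [Matrix.add_apply, Matrix.one_apply, Ed_apply]; grind
  · intro c hc
    simp only [Matrix.add_apply, Matrix.one_apply, Ed_apply]; grind
  · simp only [Matrix.add_apply, Matrix.one_apply, Ed_apply]; grind

lemma normal_empty [Fintype N] (U : Set (CIStmt N)) :
    ∃ Γ : Matrix N N ℚ, Γ.IsSymm ∧ PrinReg Γ ∧ CIS Γ ⊆ U :=
  exists_empty U fun a b C h1 h2 h3 _ =>
    ⟨1 + Ed a b, Matrix.isSymm_one.add (Ed_symm a b), edge_val a b C h1 h2 h3⟩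

lemma normal_A [Fintype N] (i j k l : N) (M : Finset N) (U : Set (CIStmt N))
    (hij : i ≠ j) (hkl : k ≠ l) (hjk : j ≠ k) (hjl : j ≠ l) (hil : i ≠ l)
    (hkM : k ∉ M) (hlM : l ∉ M) (hiM : i ∉ M) (hjM : j ∉ M)
    (hs : ((s(i, j), ∅) : CIStmt N) ∈ U) (ht : ((s(k, l), M) : CIStmt N) ∈ U)
    (h4 : i = k → M = ∅ → ((s(i, j), {l}) : CIStmt N) ∈ U ∧ ((s(i, l), {j}) : CIStmt N) ∈ U) :
    ∃ Γ : Matrix N N ℚ, Γ.IsSymm ∧ PrinReg Γ ∧ ((s(i, j), ∅) : CIStmt N) ∈ CIS Γ ∧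
      ((s(k, l), M) : CIStmt N) ∈ CIS Γ ∧ CIS Γ ⊆ U := by
  have claim1 : ∀ C, i ∉ C → j ∉ C → ((s(i, j), C) : CIStmt N) ∉ U →
      ∃ Γ : Matrix N N ℚ, Γ.IsSymm ∧ Γ i j = 0 ∧
        (∃ y : N → ℚ, ∀ c, (c ∈ M ∨ c = l) → Γ k c = ∑ m ∈ M, y m * Γ m c) ∧
        apminor Γ i j C ≠ 0 := by
    intro C hi hj hU
    by_cases hex : ∃ c ∈ C, ¬ (i = k ∧ c = l)
    · obtain ⟨c, hc, hcl⟩ := hex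
      have hci : c ≠ i := fun h => hi (h ▸ hc)
      have hcj : c ≠ j := fun h => hj (h ▸ hc)
      refine ⟨1 + Ed i c + Ed c j,
        (Matrix.isSymm_one.add (Ed_symm _ _)).add (Ed_symm _ _), ?_, ?_, ?_⟩
      · simp only [Matrix.add_apply, Matrix.one_apply, Ed_apply]; grind
      · by_cases hcM : i = k ∧ c ∈ M
        · refine ⟨yv c, fun x hx => ?_⟩
          rw [sum_yv M c hcM.2]
          simp only [Matrix.add_apply, Matrix.one_apply, Ed_apply]; grind
        · refine ⟨0, fun x hx => ?_⟩
          simp only [Pi.zero_apply, zero_mul, Finset.sum_const_zero]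
          simp only [Matrix.add_apply, Matrix.one_apply, Ed_apply]; grind
      · apply val2 _ _ _ _ _ c hc
        · intro x hx hxc
          simp only [Matrix.add_apply, Matrix.one_apply, Ed_apply]; grind
        · simp only [Matrix.add_apply, Matrix.one_apply, Ed_apply]; grind
        · simp only [Matrix.add_apply, Matrix.one_apply, Ed_apply]; grind
        · intro r hr x hx
          simp only [Matrix.add_apply, Matrix.one_apply, Ed_apply]; grind
    · push Not at hex
      rcases C.eq_empty_or_nonempty with rfl | ⟨c, hc⟩
      · exact absurd hs hU
      obtain ⟨rfl, rfl⟩ := hex c hc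
      have hC : C = {c} := by
        ext x; simp only [Finset.mem_singleton]
        exact ⟨fun h => (hex x h).2, fun h => h ▸ hc⟩
      subst hC
      rcases M.eq_empty_or_nonempty with rfl | ⟨m, hm⟩
      · exact absurd (h4 rfl rfl).1 hU
      have hmi : m ≠ i := fun h => hiM (h ▸ hm)
      have hmj : m ≠ j := fun h => hjM (h ▸ hm)
      have hmc : m ≠ c := fun h => hlM (h ▸ hm)
      refine ⟨1 + Ed i m + Ed m c + Ed i c + Ed c j,
        (((Matrix.isSymm_one.add (Ed_symm _ _)).add (Ed_symm _ _)).add (Ed_symm _ _)).add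
          (Ed_symm _ _), ?_, ?_, ?_⟩
      · simp only [Matrix.add_apply, Matrix.one_apply, Ed_apply]; grind
      · refine ⟨yv m, fun x hx => ?_⟩
        rw [sum_yv M m hm]
        simp only [Matrix.add_apply, Matrix.one_apply, Ed_apply]; grind
      · apply val2 _ _ _ _ _ c hc
        · intro x hx hxc
          simp only [Matrix.add_apply, Matrix.one_apply, Ed_apply]; grind
        · simp only [Matrix.add_apply, Matrix.one_apply, Ed_apply]; grind
        · simp only [Matrix.add_apply, Matrix.one_apply, Ed_apply]; grind
        · intro r hr x hx
          simp only [Matrix.add_apply, Matrix.one_apply, Ed_apply]; grind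
  have claim2 : ∀ C, k ∉ C → l ∉ C → ((s(k, l), C) : CIStmt N) ∉ U →
      ∃ Γ : Matrix N N ℚ, Γ.IsSymm ∧ Γ i j = 0 ∧
        (∃ y : N → ℚ, ∀ c, (c ∈ M ∨ c = l) → Γ k c = ∑ m ∈ M, y m * Γ m c) ∧
        apminor Γ k l C ≠ 0 := by
    intro C hk hl hU
    by_cases hex : ∃ m ∈ M, m ∉ C
    · obtain ⟨m, hm, hmC⟩ := hex
      have hmi : m ≠ i := fun h => hiM (h ▸ hm)
      have hmj : m ≠ j := fun h => hjM (h ▸ hm)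
      have hmk : m ≠ k := fun h => hkM (h ▸ hm)
      have hml : m ≠ l := fun h => hlM (h ▸ hm)
      refine ⟨1 + Ed k m + Ed m l + Ed k l,
        ((Matrix.isSymm_one.add (Ed_symm _ _)).add (Ed_symm _ _)).add (Ed_symm _ _), ?_, ?_, ?_⟩
      · simp only [Matrix.add_apply, Matrix.one_apply, Ed_apply]; grind
      · refine ⟨yv m, fun x hx => ?_⟩
        rw [sum_yv M m hm]
        simp only [Matrix.add_apply, Matrix.one_apply, Ed_apply]; grind
      · apply val1
        · intro r hr x hx
          simp only [Matrix.add_apply, Matrix.one_apply, Ed_apply]; grind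
        · intro x hx
          simp only [Matrix.add_apply, Matrix.one_apply, Ed_apply]; grind
        · simp only [Matrix.add_apply, Matrix.one_apply, Ed_apply]; grind
    push Not at hex
    by_cases hex2 : ∃ c ∈ C, c ∉ M ∧ ¬ (i = k ∧ c = j)
    · obtain ⟨c, hc, hcM, hne⟩ := hex2
      have hck : c ≠ k := fun h => hk (h ▸ hc)
      have hcl : c ≠ l := fun h => hl (h ▸ hc)
      refine ⟨1 + Ed k c + Ed c l,
        (Matrix.isSymm_one.add (Ed_symm _ _)).add (Ed_symm _ _), ?_, ?_, ?_⟩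
      · simp only [Matrix.add_apply, Matrix.one_apply, Ed_apply]; grind
      · refine ⟨0, fun x hx => ?_⟩
        simp only [Pi.zero_apply, zero_mul, Finset.sum_const_zero]
        simp only [Matrix.add_apply, Matrix.one_apply, Ed_apply]; grind
      · apply val2 _ _ _ _ _ c hc
        · intro x hx hxc
          simp only [Matrix.add_apply, Matrix.one_apply, Ed_apply]; grind
        · simp only [Matrix.add_apply, Matrix.one_apply, Ed_apply]; grind
        · simp only [Matrix.add_apply, Matrix.one_apply, Ed_apply]; grind
        · intro r hr x hx
          simp only [Matrix.add_apply, Matrix.one_apply, Ed_apply]; grind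
    push Not at hex2
    have hCM : ∃ c ∈ C, c ∉ M := by
      by_contra! hcon
      have : C = M := Finset.Subset.antisymm hcon hex
      subst this
      exact hU ht
    obtain ⟨c, hc, hcM⟩ := hCM
    obtain ⟨rfl, rfl⟩ := hex2 c hc hcM
    have hC : C = insert c M := by
      ext x; simp only [Finset.mem_insert]
      constructor
      · intro hx
        by_cases hxM : x ∈ M
        · exact Or.inr hxM
        · exact Or.inl (hex2 x hx hxM).2
      · rintro (rfl | h)
        · exact hc
        · exact hex x h
    rcases M.eq_empty_or_nonempty with rfl | ⟨m, hm⟩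
    · subst hC
      exact absurd (h4 rfl rfl).2 hU
    have hmi : m ≠ i := fun h => hiM (h ▸ hm)
    have hmj : m ≠ c := fun h => hcM (h ▸ hm)
    have hml : m ≠ l := fun h => hlM (h ▸ hm)
    refine ⟨1 + Ed i m + Ed m c + Ed c l,
      ((Matrix.isSymm_one.add (Ed_symm _ _)).add (Ed_symm _ _)).add (Ed_symm _ _), ?_, ?_, ?_⟩
    · simp only [Matrix.add_apply, Matrix.one_apply, Ed_apply]; grind
    · refine ⟨yv m, fun x hx => ?_⟩
      rw [sum_yv M m hm]
      simp only [Matrix.add_apply, Matrix.one_apply, Ed_apply]; grind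
    · apply apminor_ne_of_ker
      intro w v h1 h2
      have hmC := hex m hm
      have e1 : v m = 0 := by
        rw [Finset.sum_eq_single_of_mem m hmC] at h1
        · simp only [Matrix.add_apply, Matrix.one_apply, Ed_apply] at h1; grind
        · intro x hx hxm
          simp only [Matrix.add_apply, Matrix.one_apply, Ed_apply]; grind
      have e2 : v c = 0 := by
        have h2 := h2 m hmC
        rw [Finset.sum_eq_single_of_mem c hc] at h2
        · simp only [Matrix.add_apply, Matrix.one_apply, Ed_apply] at h2; grind
        · intro x hx hxm
          simp only [Matrix.add_apply, Matrix.one_apply, Ed_apply]; grind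
      have e3 : w = 0 := by
        have h2 := h2 c hc
        rw [Finset.sum_eq_zero] at h2
        · simp only [Matrix.add_apply, Matrix.one_apply, Ed_apply] at h2; grind
        · intro x hx
          simp only [Matrix.add_apply, Matrix.one_apply, Ed_apply]; grind
      refine ⟨e3, fun x hx => ?_⟩
      have h2 := h2 x hx
      rw [Finset.sum_eq_single_of_mem x hx] at h2
      · simp only [Matrix.add_apply, Matrix.one_apply, Ed_apply] at h2; grind
      · intro y hy hxm
        simp only [Matrix.add_apply, Matrix.one_apply, Ed_apply]; grind
  apply exists_A i j k l M U hij hkl hjk hjl hil hkM hlM hiM hjM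
  intro a b C hab ha hb hU
  by_cases hab1 : s(a, b) = s(i, j)
  · rw [hab1] at hU
    rcases Sym2.eq_iff.1 hab1 with ⟨rfl, rfl⟩ | ⟨rfl, rfl⟩
    · exact claim1 C ha hb hU
    · obtain ⟨Γ, g1, g2, g3, g4⟩ := claim1 C hb ha hU
      exact ⟨Γ, g1, g2, g3, by rwa [apminor_symm _ g1]⟩
  by_cases hab2 : s(a, b) = s(k, l)
  · rw [hab2] at hU
    rcases Sym2.eq_iff.1 hab2 with ⟨rfl, rfl⟩ | ⟨rfl, rfl⟩
    · exact claim2 C ha hb hU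
    · obtain ⟨Γ, g1, g2, g3, g4⟩ := claim2 C hb ha hU
      exact ⟨Γ, g1, g2, g3, by rwa [apminor_symm _ g1]⟩
  rw [Sym2.eq_iff] at hab1 hab2
  refine ⟨1 + Ed a b, Matrix.isSymm_one.add (Ed_symm a b), ?_, ?_, edge_val a b C hab ha hb⟩
  · simp only [Matrix.add_apply, Matrix.one_apply, Ed_apply]; grind
  · by_cases h1 : a = k ∧ b ∈ M
    · refine ⟨yv b, fun x hx => ?_⟩
      rw [sum_yv M b h1.2]
      simp only [Matrix.add_apply, Matrix.one_apply, Ed_apply]; grind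
    · by_cases h2 : b = k ∧ a ∈ M
      · refine ⟨yv a, fun x hx => ?_⟩
        rw [sum_yv M a h2.2]
        simp only [Matrix.add_apply, Matrix.one_apply, Ed_apply]; grind
      · refine ⟨0, fun x hx => ?_⟩
        simp only [Pi.zero_apply, zero_mul, Finset.sum_const_zero]
        simp only [Matrix.add_apply, Matrix.one_apply, Ed_apply]; grind

lemma empty_sd (Z : Finset N) : (∅ : Finset N) ∆ Z = Z := by ext x; simp [Finset.mem_symmDiff]

/-- Elementary matrix as a function. -/
def wv (c q : N) : N → N → ℚ := fun a b => if a = c ∧ b = q then 1 else 0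

lemma skewV_wv (j : N) (M : Finset N) (Γ : Matrix N N ℚ) (c q : N) (hc : c ∈ M) (hq : q ∈ M)
    (p : N) : skewV j M Γ (wv c q) p = yv c p * Γ q j - yv q p * Γ c j := by
  have h : ∀ r, (wv c q p r - wv c q r p) * Γ r j =
      yv c p * (yv q r * Γ r j) - yv q p * (yv c r * Γ r j) := by
    intro r
    simp only [wv, yv]
    by_cases h1 : p = c <;> by_cases h2 : r = q <;> by_cases h3 : p = q <;>
      by_cases h4 : r = c <;> simp [h1, h2, h3, h4] <;> grind
  simp only [skewV, h, Finset.sum_sub_distrib, ← Finset.mul_sum]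
  rw [sum_yv M q hq, sum_yv M c hc]

lemma sum_skewV_wv (j : N) (M : Finset N) (Γ : Matrix N N ℚ) (c q : N) (hc : c ∈ M)
    (hq : q ∈ M) (x : N) :
    ∑ m ∈ M, skewV j M Γ (wv c q) m * Γ m x = Γ q j * Γ c x - Γ c j * Γ q x := by
  have h : ∀ m, skewV j M Γ (wv c q) m * Γ m x =
      Γ q j * (yv c m * Γ m x) - Γ c j * (yv q m * Γ m x) := by
    intro m
    rw [skewV_wv j M Γ c q hc hq]; ring
  simp only [h, Finset.sum_sub_distrib, ← Finset.mul_sum]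
  rw [sum_yv M q hq, sum_yv M c hc]

lemma sum_skewV_zero (j : N) (M : Finset N) (Γ : Matrix N N ℚ) (x : N) :
    ∑ m ∈ M, skewV j M Γ 0 m * Γ m x = 0 := by
  simp [skewV]

lemma normal_B [Fintype N] (i j : N) (M : Finset N) (U : Set (CIStmt N))
    (hij : i ≠ j) (hiM : i ∉ M) (hjM : j ∉ M) (hM : ∀ m ∈ M, ∃ q ∈ M, q ≠ m)
    (hs : ((s(i, j), ∅) : CIStmt N) ∈ U) (ht : ((s(i, j), M) : CIStmt N) ∈ U) :
    ∃ Γ : Matrix N N ℚ, Γ.IsSymm ∧ PrinReg Γ ∧ ((s(i, j), ∅) : CIStmt N) ∈ CIS Γ ∧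
      ((s(i, j), M) : CIStmt N) ∈ CIS Γ ∧ CIS Γ ⊆ U := by
  have claim1 : ∀ C, i ∉ C → j ∉ C → ((s(i, j), C) : CIStmt N) ∉ U →
      ∃ Γ : Matrix N N ℚ, Γ.IsSymm ∧ Γ i j = 0 ∧
        (∃ w : N → N → ℚ, ∀ c ∈ M, Γ i c = ∑ m ∈ M, skewV j M Γ w m * Γ m c) ∧
        apminor Γ i j C ≠ 0 := by
    intro C hi hj hU
    by_cases hex : ∃ c ∈ C, c ∉ M
    · obtain ⟨c, hc, hcM⟩ := hex
      have hci : c ≠ i := fun h => hi (h ▸ hc)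
      have hcj : c ≠ j := fun h => hj (h ▸ hc)
      refine ⟨1 + Ed i c + Ed c j,
        (Matrix.isSymm_one.add (Ed_symm _ _)).add (Ed_symm _ _), ?_, ?_, ?_⟩
      · simp only [Matrix.add_apply, Matrix.one_apply, Ed_apply]; grind
      · refine ⟨0, fun x hx => ?_⟩
        rw [sum_skewV_zero]
        simp only [Matrix.add_apply, Matrix.one_apply, Ed_apply]; grind
      · apply val2 _ _ _ _ _ c hc
        · intro x hx hxc
          simp only [Matrix.add_apply, Matrix.one_apply, Ed_apply]; grind
        · simp only [Matrix.add_apply, Matrix.one_apply, Ed_apply]; grind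
        · simp only [Matrix.add_apply, Matrix.one_apply, Ed_apply]; grind
        · intro r hr x hx
          simp only [Matrix.add_apply, Matrix.one_apply, Ed_apply]; grind
    push Not at hex
    rcases C.eq_empty_or_nonempty with rfl | ⟨c, hc⟩
    · exact absurd hs hU
    have hq : ∃ q ∈ M, q ∉ C := by
      by_contra! hcon
      have : C = M := Finset.Subset.antisymm hex hcon
      subst this
      exact hU ht
    obtain ⟨q, hq, hqC⟩ := hq
    have hcM := hex c hc
    have hci : c ≠ i := fun h => hi (h ▸ hc)
    have hcj : c ≠ j := fun h => hj (h ▸ hc)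
    have hqi : q ≠ i := fun h => hiM (h ▸ hq)
    have hqj : q ≠ j := fun h => hjM (h ▸ hq)
    have hqc : q ≠ c := fun h => hqC (h ▸ hc)
    refine ⟨1 + Ed i c + Ed c j + Ed q j - Ed i q,
      (((Matrix.isSymm_one.add (Ed_symm _ _)).add (Ed_symm _ _)).add (Ed_symm _ _)).sub
        (Ed_symm _ _), ?_, ?_, ?_⟩
    · simp only [Matrix.add_apply, Matrix.sub_apply, Matrix.one_apply, Ed_apply]; grind
    · refine ⟨wv c q, fun x hx => ?_⟩
      rw [sum_skewV_wv j M _ c q hcM hq]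
      simp only [Matrix.add_apply, Matrix.sub_apply, Matrix.one_apply, Ed_apply]; grind
    · apply val2 _ _ _ _ _ c hc
      · intro x hx hxc
        simp only [Matrix.add_apply, Matrix.sub_apply, Matrix.one_apply, Ed_apply]; grind
      · simp only [Matrix.add_apply, Matrix.sub_apply, Matrix.one_apply, Ed_apply]; grind
      · simp only [Matrix.add_apply, Matrix.sub_apply, Matrix.one_apply, Ed_apply]; grind
      · intro r hr x hx
        simp only [Matrix.add_apply, Matrix.sub_apply, Matrix.one_apply, Ed_apply]; grind
  have claim2 : ∀ m ∈ M, ∀ C, i ∉ C → m ∉ C →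
      ∃ Γ : Matrix N N ℚ, Γ.IsSymm ∧ Γ i j = 0 ∧
        (∃ w : N → N → ℚ, ∀ c ∈ M, Γ i c = ∑ m ∈ M, skewV j M Γ w m * Γ m c) ∧
        apminor Γ i m C ≠ 0 := by
    intro m hm C hi hmC
    obtain ⟨q, hq, hqm⟩ := hM m hm
    have hmi : m ≠ i := fun h => hiM (h ▸ hm)
    have hmj : m ≠ j := fun h => hjM (h ▸ hm)
    have hqi : q ≠ i := fun h => hiM (h ▸ hq)
    have hqj : q ≠ j := fun h => hjM (h ▸ hq)
    refine ⟨1 + Ed i m + Ed i m + Ed j q + Ed j q,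
      (((Matrix.isSymm_one.add (Ed_symm _ _)).add (Ed_symm _ _)).add (Ed_symm _ _)).add
        (Ed_symm _ _), ?_, ?_, ?_⟩
    · simp only [Matrix.add_apply, Matrix.one_apply, Ed_apply]; grind
    · refine ⟨wv m q, fun x hx => ?_⟩
      rw [sum_skewV_wv j M _ m q hm hq]
      simp only [Matrix.add_apply, Matrix.one_apply, Ed_apply]; grind
    · by_cases hjq : j ∈ C ∧ q ∈ C
      · apply apminor_ne_of_ker
        intro w v h1 h2
        have e1 : w = 0 := by
          rw [Finset.sum_eq_zero] at h1
          · simp only [Matrix.add_apply, Matrix.one_apply, Ed_apply] at h1; grind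
          · intro x hx
            simp only [Matrix.add_apply, Matrix.one_apply, Ed_apply]; grind
        have e2 : v j + 2 * v q = 0 := by
          have h2 := h2 j hjq.1
          rw [Finset.sum_eq_add_of_mem j q hjq.1 hjq.2 hqj.symm] at h2
          · simp only [Matrix.add_apply, Matrix.one_apply, Ed_apply] at h2; grind
          · intro x hx hxm
            simp only [Matrix.add_apply, Matrix.one_apply, Ed_apply]; grind
        have e3 : 2 * v j + v q = 0 := by
          have h2 := h2 q hjq.2
          rw [Finset.sum_eq_add_of_mem j q hjq.1 hjq.2 hqj.symm] at h2
          · simp only [Matrix.add_apply, Matrix.one_apply, Ed_apply] at h2; grind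
          · intro x hx hxm
            simp only [Matrix.add_apply, Matrix.one_apply, Ed_apply]; grind
        have e4 : v j = 0 := by linarith
        have e5 : v q = 0 := by linarith
        refine ⟨e1, fun x hx => ?_⟩
        have h2 := h2 x hx
        rw [Finset.sum_eq_single_of_mem x hx] at h2
        · simp only [Matrix.add_apply, Matrix.one_apply, Ed_apply] at h2; grind
        · intro y hy hxm
          simp only [Matrix.add_apply, Matrix.one_apply, Ed_apply]; grind
      · apply val1
        · intro r hr x hx
          simp only [Matrix.add_apply, Matrix.one_apply, Ed_apply]; grind
        · intro x hx
          simp only [Matrix.add_apply, Matrix.one_apply, Ed_apply]; grind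
        · simp only [Matrix.add_apply, Matrix.one_apply, Ed_apply]; grind
  apply exists_B i j M U hij hiM hjM
  intro a b C hab ha hb hU
  by_cases hab1 : s(a, b) = s(i, j)
  · rw [hab1] at hU
    rcases Sym2.eq_iff.1 hab1 with ⟨rfl, rfl⟩ | ⟨rfl, rfl⟩
    · exact claim1 C ha hb hU
    · obtain ⟨Γ, g1, g2, g3, g4⟩ := claim1 C hb ha hU
      exact ⟨Γ, g1, g2, g3, by rwa [apminor_symm _ g1]⟩
  by_cases h1 : a = i ∧ b ∈ M
  · obtain ⟨rfl, hm⟩ := h1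
    exact claim2 b hm C ha hb
  by_cases h2 : b = i ∧ a ∈ M
  · obtain ⟨rfl, hm⟩ := h2
    obtain ⟨Γ, g1, g2, g3, g4⟩ := claim2 a hm C hb ha
    exact ⟨Γ, g1, g2, g3, by rwa [apminor_symm _ g1]⟩
  rw [Sym2.eq_iff] at hab1
  refine ⟨1 + Ed a b, Matrix.isSymm_one.add (Ed_symm a b), ?_, ?_, edge_val a b C hab ha hb⟩
  · simp only [Matrix.add_apply, Matrix.one_apply, Ed_apply]; grind
  · refine ⟨0, fun x hx => ?_⟩
    rw [sum_skewV_zero]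
    simp only [Matrix.add_apply, Matrix.one_apply, Ed_apply]; grind

/-- Reflection of CI statements at the set `Z`. -/
def flp (Z : Finset N) (s : CIStmt N) : CIStmt N := (s.1, (s.2 ∆ Z).filter (· ∉ s.1))

lemma flp_mk (Z : Finset N) (a b : N) (C : Finset N) :
    flp Z (s(a, b), C) = (s(a, b), (C ∆ Z) \ {a, b}) := by
  simp only [flp, Prod.mk.injEq, true_and]
  ext x
  simp [Finset.mem_filter, Finset.mem_sdiff]

lemma flp_flp (Z : Finset N) (a b : N) (C : Finset N) (ha : a ∉ C) (hb : b ∉ C) :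
    ((C ∆ Z) \ {a, b}) ∆ Z \ {a, b} = C := by
  ext x
  simp only [Finset.mem_sdiff, Finset.mem_symmDiff, Finset.mem_insert, Finset.mem_singleton]
  grind

/-- Transport of a realization along a reflection. -/
lemma transport [Fintype N] (G : Set (CIStmt N)) (Z : Finset N) (Γ : Matrix N N ℚ)
    (h1 : Γ.IsSymm) (h2 : PrinReg Γ) (h3 : CIS Γ ⊆ {u | flp Z u ∈ G}) :
    ∃ Γ' : Matrix N N ℚ, Γ'.IsSymm ∧ PrinReg Γ' ∧ CIS Γ' ⊆ G ∧
      ∀ a b C, a ∉ C → b ∉ C → flp Z (s(a, b), C) ∈ CIS Γ →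
        ((s(a, b), C) : CIStmt N) ∈ CIS Γ' := by
  obtain ⟨Γ', g1, g2, g3⟩ := sweep Γ h1 h2 Z
  refine ⟨Γ', g1, g2, ?_, ?_⟩
  · rintro ⟨e, C⟩ hs
    induction e using Sym2.ind with
    | _ a b =>
    rw [mem_CIS_iff _ g1] at hs
    obtain ⟨⟨hab, ha, hb⟩, h0⟩ := hs
    rw [g3 a b C hab ha hb] at h0
    have := h3 ((mem_CIS_iff Γ h1 a b _).2 ⟨⟨hab, by simp, by simp⟩, h0⟩)
    simp only [Set.mem_setOf_eq] at this
    rwa [flp_mk, flp_flp Z a b C ha hb] at this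
  · intro a b C ha hb h
    rw [flp_mk, mem_CIS_iff _ h1] at h
    rw [mem_CIS_iff _ g1]
    exact ⟨⟨h.1.1, ha, hb⟩, (g3 a b C h.1.1 ha hb).2 h.2⟩

lemma gaussoid4 (G : Set (CIStmt N)) (hG : IsGaussoid G) (i j l : N) (hij : i ≠ j) (hil : i ≠ l)
    (hjl : j ≠ l) (Z : Finset N) (h1 : ((s(i, j), Z \ {i, j}) : CIStmt N) ∈ G)
    (h2 : ((s(i, l), Z \ {i, l}) : CIStmt N) ∈ G) :
    ((s(i, j), ({l} ∆ Z) \ {i, j}) : CIStmt N) ∈ G ∧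
      ((s(i, l), ({j} ∆ Z) \ {i, l}) : CIStmt N) ∈ G := by
  let L := Z \ {i, j, l}
  have hi : i ∉ L := by simp [L]
  have hj : j ∉ L := by simp [L]
  have hl : l ∉ L := by simp [L]
  obtain ⟨a1, a2, -⟩ := hG.2 i j l L hij hil hjl hi hj hl
  by_cases hjZ : j ∈ Z <;> by_cases hlZ : l ∈ Z
  · have e1 : Z \ {i, j} = insert l L := by ext x; simp [L]; grind
    have e2 : Z \ {i, l} = insert j L := by ext x; simp [L]; grind
    have e3 : ({l} ∆ Z) \ {i, j} = L := by ext x; simp [L, Finset.mem_symmDiff]; grind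
    have e4 : ({j} ∆ Z) \ {i, l} = L := by ext x; simp [L, Finset.mem_symmDiff]; grind
    rw [e1] at h1; rw [e2] at h2; rw [e3, e4]
    tauto
  · have e1 : Z \ {i, j} = L := by ext x; simp [L]; grind
    have e2 : Z \ {i, l} = insert j L := by ext x; simp [L]; grind
    have e3 : ({l} ∆ Z) \ {i, j} = insert l L := by ext x; simp [L, Finset.mem_symmDiff]; grind
    have e4 : ({j} ∆ Z) \ {i, l} = L := by ext x; simp [L, Finset.mem_symmDiff]; grind
    rw [e1] at h1; rw [e2] at h2; rw [e3, e4]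
    tauto
  · have e1 : Z \ {i, j} = insert l L := by ext x; simp [L]; grind
    have e2 : Z \ {i, l} = L := by ext x; simp [L]; grind
    have e3 : ({l} ∆ Z) \ {i, j} = L := by ext x; simp [L, Finset.mem_symmDiff]; grind
    have e4 : ({j} ∆ Z) \ {i, l} = insert j L := by ext x; simp [L, Finset.mem_symmDiff]; grind
    rw [e1] at h1; rw [e2] at h2; rw [e3, e4]
    tauto
  · have e1 : Z \ {i, j} = L := by ext x; simp [L]; grind
    have e2 : Z \ {i, l} = L := by ext x; simp [L]; grind
    have e3 : ({l} ∆ Z) \ {i, j} = insert l L := by ext x; simp [L, Finset.mem_symmDiff]; grind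
    have e4 : ({j} ∆ Z) \ {i, l} = insert j L := by ext x; simp [L, Finset.mem_symmDiff]; grind
    rw [e1] at h1; rw [e2] at h2; rw [e3, e4]
    tauto

/-- Two statements on different pairs; `i = k` is the only allowed coincidence. -/
lemma realize_A [Fintype N] (G : Set (CIStmt N)) (hG : IsGaussoid G) (i j k l : N)
    (K M : Finset N) (hij : i ≠ j) (hkl : k ≠ l) (hjk : j ≠ k) (hjl : j ≠ l) (hil : i ≠ l)
    (hiK : i ∉ K) (hjK : j ∉ K) (hkM : k ∉ M) (hlM : l ∉ M)
    (hs : ((s(i, j), K) : CIStmt N) ∈ G) (ht : ((s(k, l), M) : CIStmt N) ∈ G) :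
    ∃ Γ : Matrix N N ℚ, Γ.IsSymm ∧ PrinReg Γ ∧ CIS Γ ⊆ G ∧
      ((s(i, j), K) : CIStmt N) ∈ CIS Γ ∧ ((s(k, l), M) : CIStmt N) ∈ CIS Γ := by
  let Z := K ∪ (M ∩ {i, j})
  have hKZ : (K ∆ Z) \ {i, j} = ∅ := by
    ext x; simp [Z, Finset.mem_symmDiff]; grind
  have hZK : (∅ ∆ Z) \ {i, j} = K := by rw [← hKZ]; exact flp_flp Z i j K hiK hjK
  have hMM := flp_flp Z k l M hkM hlM
  obtain ⟨Γ, g1, g2, g3, g4, g5⟩ := normal_A i j k l ((M ∆ Z) \ {k, l}) {u | flp Z u ∈ G}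
    hij hkl hjk hjl hil (by simp) (by simp)
    (by simp [Z, Finset.mem_symmDiff]; grind) (by simp [Z, Finset.mem_symmDiff]; grind)
    (by simp only [Set.mem_setOf_eq, flp_mk]; rwa [hZK])
    (by simp only [Set.mem_setOf_eq, flp_mk]; rwa [hMM])
    (by
      rintro rfl h0
      simp only [Set.mem_setOf_eq, flp_mk]
      rw [h0] at hMM
      apply gaussoid4 G hG i j l hij hil hjl Z
      · rw [← hZK] at hs
        simpa [empty_sd] using hs
      · rw [← hMM] at ht
        simpa [empty_sd] using ht)
  obtain ⟨Γ', f1, f2, f3, f4⟩ := transport G Z Γ g1 g2 g5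
  refine ⟨Γ', f1, f2, f3, f4 i j K hiK hjK ?_, f4 k l M hkM hlM ?_⟩
  · rwa [flp_mk, hKZ]
  · rwa [flp_mk]

lemma four_extra [Fintype N] (Γ : Matrix N N ℚ) (h1 : Γ.IsSymm) (h2 : PrinReg Γ) (i j m : N)
    (L : Finset N) (hij : i ≠ j) (him : i ≠ m) (hjm : j ≠ m) (hi : i ∉ L) (hj : j ∉ L)
    (hm : m ∉ L) (hs : ((s(i, j), L) : CIStmt N) ∈ CIS Γ)
    (ht : ((s(i, m), L) : CIStmt N) ∈ CIS Γ) :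
    ((s(i, j), insert m L) : CIStmt N) ∈ CIS Γ := by
  obtain ⟨Γ', g1, g2, g3⟩ := sweep Γ h1 h2 L
  rw [mem_CIS_iff _ h1] at hs ht ⊢
  refine ⟨⟨hij, by simp [him, hi], by simp [hjm, hj]⟩, ?_⟩
  have e1 : (∅ ∆ L) \ {i, j} = L := by ext x; simp [empty_sd]; grind
  have e2 : (∅ ∆ L) \ {i, m} = L := by ext x; simp [empty_sd]; grind
  have e3 : ({m} ∆ L) \ {i, j} = insert m L := by ext x; simp [Finset.mem_symmDiff]; grind
  have k1 := (g3 i j ∅ hij (by simp) (by simp)).2 (by rw [e1]; exact hs.2)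
  have k2 := (g3 i m ∅ him (by simp) (by simp)).2 (by rw [e2]; exact ht.2)
  rw [apminor_empty] at k1 k2
  have k3 := (g3 i j {m} hij (by simpa using him) (by simpa using hjm)).1 (by
    apply apminor_zero_of_comb _ _ _ _ 0
    rintro c (hc | rfl)
    · rw [Finset.mem_singleton] at hc
      subst hc; simpa using k2
    · simpa using k1)
  rwa [e3] at k3

/-- The pair `(ij|L)`, `(ij|mL)`. -/
lemma realize_weak [Fintype N] (G : Set (CIStmt N)) (hG : IsGaussoid G) (i j m : N)
    (L : Finset N) (hij : i ≠ j) (him : i ≠ m) (hjm : j ≠ m) (hi : i ∉ L) (hj : j ∉ L)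
    (hm : m ∉ L)
    (hs : ((s(i, j), L) : CIStmt N) ∈ G) (ht : ((s(i, j), insert m L) : CIStmt N) ∈ G) :
    ∃ Γ : Matrix N N ℚ, Γ.IsSymm ∧ PrinReg Γ ∧ CIS Γ ⊆ G ∧
      ((s(i, j), L) : CIStmt N) ∈ CIS Γ ∧ ((s(i, j), insert m L) : CIStmt N) ∈ CIS Γ := by
  rcases (hG.2 i j m L hij him hjm hi hj hm).2.2 ⟨hs, ht⟩ with h | h
  · obtain ⟨Γ, g1, g2, g3, g4, g5⟩ := realize_A G hG i j i m L L hij him hij.symm hjm him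
      hi hj hi hm hs h
    exact ⟨Γ, g1, g2, g3, g4, four_extra Γ g1 g2 i j m L hij him hjm hi hj hm g4 g5⟩
  · rw [Sym2.eq_swap] at hs
    obtain ⟨Γ, g1, g2, g3, g4, g5⟩ := realize_A G hG j i j m L L hij.symm hjm hij him hjm
      hj hi hj hm hs h
    have := four_extra Γ g1 g2 j i m L hij.symm hjm him hj hi hm g4 g5
    rw [Sym2.eq_swap] at g4 this
    exact ⟨Γ, g1, g2, g3, g4, this⟩

lemma realize_B [Fintype N] (G : Set (CIStmt N)) (hG : IsGaussoid G) (i j : N)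
    (K M : Finset N) (hij : i ≠ j)
    (hiK : i ∉ K) (hjK : j ∉ K) (hiM : i ∉ M) (hjM : j ∉ M)
    (hs : ((s(i, j), K) : CIStmt N) ∈ G) (ht : ((s(i, j), M) : CIStmt N) ∈ G) :
    ∃ Γ : Matrix N N ℚ, Γ.IsSymm ∧ PrinReg Γ ∧ CIS Γ ⊆ G ∧
      ((s(i, j), K) : CIStmt N) ∈ CIS Γ ∧ ((s(i, j), M) : CIStmt N) ∈ CIS Γ := by
  by_cases hone : ∃ m, (M ∆ K) \ {i, j} = {m}
  · obtain ⟨m, hm⟩ := hone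
    have hm' : ∀ x, x ∈ M ∆ K ↔ x = m := by
      intro x
      rw [← Finset.mem_singleton, ← hm]
      simp [Finset.mem_symmDiff]; grind
    simp only [Finset.mem_symmDiff] at hm'
    have hmm := (hm' m).2 rfl
    rcases hmm with ⟨h1, h2⟩ | ⟨h1, h2⟩
    · have hMK : M = insert m K := by ext x; have := hm' x; simp; grind
      subst hMK
      exact realize_weak G hG i j m K hij (by grind) (by grind) hiK hjK h2 hs ht
    · have hMK : K = insert m M := by ext x; have := hm' x; simp; grind
      subst hMK
      obtain ⟨Γ, g1, g2, g3, g4, g5⟩ :=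
        realize_weak G hG i j m M hij (by grind) (by grind) hiM hjM h2 ht hs
      exact ⟨Γ, g1, g2, g3, g5, g4⟩
  · have hKZ : (K ∆ K) \ {i, j} = ∅ := by simp
    have hZK : (∅ ∆ K) \ {i, j} = K := by rw [← hKZ]; exact flp_flp K i j K hiK hjK
    have hMM := flp_flp K i j M hiM hjM
    obtain ⟨Γ, g1, g2, g3, g4, g5⟩ := normal_B i j ((M ∆ K) \ {i, j}) {u | flp K u ∈ G}
      hij (by simp) (by simp)
      (by
        intro m hm
        by_contra! hcon
        exact hone ⟨m, by
          ext x; rw [Finset.mem_singleton]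
          exact ⟨fun h => hcon x h, fun h => h ▸ hm⟩⟩)
      (by simp only [Set.mem_setOf_eq, flp_mk]; rwa [hZK])
      (by simp only [Set.mem_setOf_eq, flp_mk]; rwa [hMM])
    obtain ⟨Γ', f1, f2, f3, f4⟩ := transport G K Γ g1 g2 g5
    refine ⟨Γ', f1, f2, f3, f4 i j K hiK hjK ?_, f4 i j M hiM hjM ?_⟩
    · rwa [flp_mk, hKZ]
    · rwa [flp_mk]

lemma realize_pair [Fintype N] (G : Set (CIStmt N)) (hG : IsGaussoid G) (s t : CIStmt N)
    (hs : s ∈ G) (ht : t ∈ G) :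
    ∃ Γ : Matrix N N ℚ, Γ.IsSymm ∧ PrinReg Γ ∧ CIS Γ ⊆ G ∧ s ∈ CIS Γ ∧ t ∈ CIS Γ := by
  have ps := hG.1 s hs
  have pt := hG.1 t ht
  obtain ⟨e, K⟩ := s
  obtain ⟨f, M⟩ := t
  induction e using Sym2.ind with
  | _ i j =>
  induction f using Sym2.ind with
  | _ k l =>
  have hij : i ≠ j := by simpa using ps.1
  have hkl : k ≠ l := by simpa using pt.1
  have hiK : i ∉ K := ps.2 i (by simp)
  have hjK : j ∉ K := ps.2 j (by simp)
  have hkM : k ∉ M := pt.2 k (by simp)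
  have hlM : l ∉ M := pt.2 l (by simp)
  clear ps pt
  by_cases hef : s(k, l) = s(i, j)
  · rw [hef] at ht ⊢
    have : i ∉ M ∧ j ∉ M := by
      rcases Sym2.eq_iff.1 hef with ⟨rfl, rfl⟩ | ⟨rfl, rfl⟩
      · exact ⟨hkM, hlM⟩
      · exact ⟨hlM, hkM⟩
    exact realize_B G hG i j K M hij hiK hjK this.1 this.2 hs ht
  rw [Sym2.eq_iff] at hef
  by_cases c1 : j = k
  · rw [Sym2.eq_swap (a := i)] at hs ⊢
    exact realize_A G hG j i k l K M hij.symm hkl (by grind) (by grind) (by grind)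
      hjK hiK hkM hlM hs ht
  by_cases c2 : j = l
  · rw [Sym2.eq_swap (a := i)] at hs ⊢
    rw [Sym2.eq_swap (a := k)] at ht ⊢
    exact realize_A G hG j i l k K M hij.symm hkl.symm (by grind) (by grind) (by grind)
      hjK hiK hlM hkM hs ht
  by_cases c3 : i = l
  · rw [Sym2.eq_swap (a := k)] at ht ⊢
    exact realize_A G hG i j l k K M hij hkl.symm (by grind) (by grind) (by grind)
      hiK hjK hlM hkM hs ht
  exact realize_A G hG i j k l K M hij hkl c1 c2 c3 hiK hjK hkM hlM hs ht

/-- gaussoids are a two-antecedental approximation of algebraic Gaussian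
CI structures over the rationals. -/
theorem stmt2 {N : Type*} [Fintype N] [DecidableEq N]
    (L M : Set (CIStmt N))
    (hLproper : ∀ s ∈ L, s.proper) (hMproper : ∀ s ∈ M, s.proper)
    (hLcard : L.encard ≤ 2)
    (hvalid : ∀ Γ : Matrix N N ℚ, Γ.IsSymm → PrinReg Γ →
      L ⊆ CIS Γ → (CIS Γ ∩ M).Nonempty) :
    ∀ G : Set (CIStmt N), IsGaussoid G → L ⊆ G → (G ∩ M).Nonempty := by
  intro G hG hLG
  have key : ∃ Γ : Matrix N N ℚ, Γ.IsSymm ∧ PrinReg Γ ∧ CIS Γ ⊆ G ∧ L ⊆ CIS Γ := by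
    rcases L.eq_empty_or_nonempty with rfl | ⟨s, hs⟩
    · obtain ⟨Γ, g1, g2, g3⟩ := normal_empty G
      exact ⟨Γ, g1, g2, g3, Set.empty_subset _⟩
    · have : ∃ t ∈ L, L ⊆ {s, t} := by
        by_cases h : ∃ t ∈ L, t ≠ s
        · obtain ⟨t, ht, hts⟩ := h
          refine ⟨t, ht, fun u hu => ?_⟩
          by_contra hne
          simp only [Set.mem_insert_iff, Set.mem_singleton_iff, not_or] at hne
          have h3 : ({u, s, t} : Set (CIStmt N)).encard = 3 :=
            Set.encard_eq_three.2 ⟨u, s, t, hne.1, hne.2, hts.symm, rfl⟩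
          have hle : ({u, s, t} : Set (CIStmt N)).encard ≤ L.encard :=
            Set.encard_le_encard (by
              rintro x (rfl | rfl | rfl) <;> assumption)
          rw [h3] at hle
          exact absurd (hle.trans hLcard) (by norm_num)
        · push Not at h
          exact ⟨s, hs, fun u hu => by simp [h u hu]⟩
      obtain ⟨t, ht, hst⟩ := this
      obtain ⟨Γ, g1, g2, g3, g4, g5⟩ := realize_pair G hG s t (hLG hs) (hLG ht)
      refine ⟨Γ, g1, g2, g3, fun u hu => ?_⟩
      rcases hst hu with rfl | rfl
      · exact g4
      · exact g5
  obtain ⟨Γ, g1, g2, g3, g4⟩ := key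
  obtain ⟨u, hu, huM⟩ := hvalid Γ g1 g2 g4
  exact ⟨u, g3 hu, huM⟩
end

section
/- Let N be a finite set and let 𝔸 ⊇ 𝔸* be two families of subsets of A_N. Fix k ∈ ℕ and suppose that for every B ⊆ A_N with |B| ≤ k, every minimal 𝔸-extension of B (i.e. every A' ∈ 𝔸 with B ⊆ A' that is inclusion-minimal among members of 𝔸 containing B) belongs to 𝔸*. Then 𝔸 is a k-antecedental approximation of 𝔸*: for all L ⊆ A_N with |L| ≤ k and all M ⊆ A_N, if every A* ∈ 𝔸* with L ⊆ A* satisfies A* ∩ M ≠ ∅, then every A ∈ 𝔸 with L ⊆ A satisfies A ∩ M ≠ ∅. -/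
open scoped symmDiff

variable {N : Type*} [DecidableEq N]

/-- if every minimal 𝔸-extension of every set of at most k CI statements
belongs to 𝔸*, then 𝔸 is a k-antecedental approximation of 𝔸*. -/
theorem stmt3 {N : Type*} [Fintype N] [DecidableEq N]
    (𝔸 𝔸s : Set (Set (CIStmt N)))
    (hproper : ∀ A ∈ 𝔸, ∀ s ∈ A, CIStmt.proper s)
    (hsub : 𝔸s ⊆ 𝔸) (k : ℕ)
    (hext : ∀ B : Set (CIStmt N), (∀ s ∈ B, s.proper) → B.encard ≤ k →
      ∀ A' ∈ 𝔸, B ⊆ A' →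
        (∀ A'' ∈ 𝔸, B ⊆ A'' → A'' ⊆ A' → A'' = A') → A' ∈ 𝔸s) :
    ∀ L M : Set (CIStmt N), (∀ s ∈ L, s.proper) → (∀ s ∈ M, s.proper) →
      L.encard ≤ k →
      (∀ As ∈ 𝔸s, L ⊆ As → (As ∩ M).Nonempty) →
      ∀ A ∈ 𝔸, L ⊆ A → (A ∩ M).Nonempty := by
  intro L M hL _ hk h A hA hLA
  have hfin : {B : Set (CIStmt N) | B ∈ 𝔸 ∧ L ⊆ B}.Finite := Set.toFinite _
  obtain ⟨B, hBA, hB⟩ := hfin.exists_le_minimal (a := A) ⟨hA, hLA⟩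
  have hBs : B ∈ 𝔸s := hext L hL hk B hB.prop.1 hB.prop.2
    (fun C hC hLC hCB => Set.Subset.antisymm hCB (hB.le_of_le ⟨hC, hLC⟩ hCB))
  exact (h B hBs hB.prop.2).mono (Set.inter_subset_inter_left M hBA)
end

section
/- Let 𝕂 be an infinite field, N a finite set, and Γ a principally regular symmetric matrix indexed by N with entries in the field RatFunc 𝕂 of rational functions in one variable over 𝕂. Then for all but finitely many a ∈ 𝕂, the entrywise evaluation Γ(a) is defined (no entry of Γ has a pole at a), Γ(a) is a principally regular symmetric matrix over 𝕂, and CIS(Γ(a)) = CIS(Γ). In particular, a gaussoid is algebraically realizable over RatFunc 𝕂 if and only if it is algebraically realizable over 𝕂. -/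
open scoped symmDiff

variable {N : Type*} [DecidableEq N]

open Filter in
theorem denom_ev (𝕂 : Type*) [Field 𝕂] (r : RatFunc 𝕂) :
    ∀ᶠ a in cofinite, Polynomial.eval a r.denom ≠ 0 := by
  classical
  have h := (r.denom).roots.toFinset.finite_toSet
  refine Set.Finite.subset h ?_
  intro a ha
  have ha' : Polynomial.eval a r.denom = 0 := by simpa using ha
  simp [r.denom_ne_zero, ha']

open Filter in
theorem poly_ev (𝕂 : Type*) [Field 𝕂] (p : Polynomial 𝕂) :
    ∀ᶠ a in cofinite, (Polynomial.eval a p = 0 ↔ p = 0) := by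
  by_cases hp : p = 0
  · simp [hp]
  classical
  have h := p.roots.toFinset.finite_toSet
  refine Set.Finite.subset h ?_
  intro a ha
  have ha' : Polynomial.eval a p = 0 := by simpa [hp] using ha
  simp [hp, ha']

set_option maxHeartbeats 2000000 in
open Filter in
theorem det_ev (𝕂 : Type*) [Field 𝕂] {n : Type*} [Fintype n] [DecidableEq n]
    (A : Matrix n n (RatFunc 𝕂)) :
    ∀ᶠ a in cofinite,
      ((Matrix.of fun i j => RatFunc.eval (RingHom.id 𝕂) a (A i j)).det = 0 ↔ A.det = 0) := by
  classical
  let D : Polynomial 𝕂 := ∏ p : n × n, (A p.1 p.2).denom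
  have hD : D ≠ 0 := Finset.prod_ne_zero_iff.2 fun p _ => (A p.1 p.2).denom_ne_zero
  have hdvd : ∀ i j, (A i j).denom ∣ D := fun i j =>
    Finset.dvd_prod_of_mem (fun p : n × n => (A p.1 p.2).denom) (Finset.mem_univ (i, j))
  clear_value D
  choose q hq using hdvd
  let M : Matrix n n (Polynomial 𝕂) := Matrix.of fun i j => (A i j).num * q i j
  have hM : (algebraMap (Polynomial 𝕂) (RatFunc 𝕂)).mapMatrix M
      = (algebraMap (Polynomial 𝕂) (RatFunc 𝕂) D) • A := by
    ext i j
    have h1 : algebraMap (Polynomial 𝕂) (RatFunc 𝕂) (A i j).denom ≠ 0 :=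
      RatFunc.algebraMap_ne_zero (A i j).denom_ne_zero
    have h2 := (div_eq_iff h1).1 (RatFunc.num_div_denom (A i j))
    simp only [RingHom.mapMatrix_apply, Matrix.map_apply, Matrix.smul_apply, smul_eq_mul, M,
      Matrix.of_apply, map_mul]
    rw [h2, hq i j, map_mul]
    ring
  have hdet : M.det = 0 ↔ A.det = 0 := by
    have h := congrArg Matrix.det hM
    rw [← RingHom.map_det, Matrix.det_smul] at h
    have hD' := RatFunc.algebraMap_ne_zero hD
    rw [← map_eq_zero_iff _ (RatFunc.algebraMap_injective 𝕂), h]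
    simp [hD']
  filter_upwards [poly_ev 𝕂 D, poly_ev 𝕂 M.det] with a h1 h2
  have hDa : Polynomial.eval a D ≠ 0 := fun h => hD (h1.1 h)
  have hMa : (Polynomial.evalRingHom a).mapMatrix M = (Polynomial.eval a D) •
      (Matrix.of fun i j => RatFunc.eval (RingHom.id 𝕂) a (A i j)) := by
    ext i j
    have h3 := hDa
    rw [hq i j, Polynomial.eval_mul] at h3
    have h4 := left_ne_zero_of_mul h3
    simp only [RingHom.mapMatrix_apply, Matrix.map_apply, Matrix.smul_apply, smul_eq_mul, M,
      Matrix.of_apply, map_mul, Polynomial.coe_evalRingHom, RatFunc.eval,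
      Polynomial.eval₂_id]
    rw [hq i j, Polynomial.eval_mul, Polynomial.eval_mul]
    field_simp
  have h := congrArg Matrix.det hMa
  rw [← RingHom.map_det, Matrix.det_smul, Polynomial.coe_evalRingHom] at h
  rw [← hdet, ← h2, h]
  simp [hDa]

open Filter in
theorem main_ev {N : Type*} [Fintype N] [DecidableEq N] (𝕂 : Type*) [Field 𝕂]
    (Γ : Matrix N N (RatFunc 𝕂)) (hsym : Γ.IsSymm) (hpr : PrinReg Γ) :
    ∀ᶠ a in cofinite,
      (∀ i j : N, Polynomial.eval a (Γ i j).denom ≠ 0) ∧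
      (Matrix.of fun i j => RatFunc.eval (RingHom.id 𝕂) a (Γ i j)).IsSymm ∧
      PrinReg (Matrix.of fun i j => RatFunc.eval (RingHom.id 𝕂) a (Γ i j)) ∧
      CIS (Matrix.of fun i j => RatFunc.eval (RingHom.id 𝕂) a (Γ i j)) = CIS Γ := by
  have e1 : ∀ᶠ a in cofinite, ∀ i j : N, Polynomial.eval a (Γ i j).denom ≠ 0 :=
    eventually_all.2 fun i => eventually_all.2 fun j => denom_ev 𝕂 (Γ i j)
  have e2 : ∀ᶠ a in cofinite, ∀ S : Finset N,
      (pminor (Matrix.of fun i j => RatFunc.eval (RingHom.id 𝕂) a (Γ i j)) S = 0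
        ↔ pminor Γ S = 0) :=
    eventually_all.2 fun S => det_ev 𝕂 _
  have e3 : ∀ᶠ a in cofinite, ∀ (i j : N) (S : Finset N),
      (apminor (Matrix.of fun i j => RatFunc.eval (RingHom.id 𝕂) a (Γ i j)) i j S = 0
        ↔ apminor Γ i j S = 0) :=
    eventually_all.2 fun i => eventually_all.2 fun j => eventually_all.2 fun S => det_ev 𝕂 _
  filter_upwards [e1, e2, e3] with a h1 h2 h3
  refine ⟨h1, ?_, fun S hS => hpr S ((h2 S).1 hS), ?_⟩
  · ext i j
    simp [Matrix.transpose_apply, hsym.apply i j]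
  · ext s
    simp only [CIS, Set.mem_ofPred_eq, h3]

/-- evaluating a principally regular symmetric matrix of rational functions
at all but finitely many points of an infinite field preserves principal regularity and
the CI structure; hence algebraic realizability over `RatFunc 𝕂` and over `𝕂` agree. -/
theorem stmt5 {N : Type*} [Fintype N] [DecidableEq N] (𝕂 : Type*) [Field 𝕂] [Infinite 𝕂]
    (Γ : Matrix N N (RatFunc 𝕂)) (hsym : Γ.IsSymm) (hpr : PrinReg Γ) :
    (∃ F : Finset 𝕂, ∀ a : 𝕂, a ∉ F →
      (∀ i j : N, Polynomial.eval a (Γ i j).denom ≠ 0) ∧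
      (Matrix.of fun i j => RatFunc.eval (RingHom.id 𝕂) a (Γ i j)).IsSymm ∧
      PrinReg (Matrix.of fun i j => RatFunc.eval (RingHom.id 𝕂) a (Γ i j)) ∧
      CIS (Matrix.of fun i j => RatFunc.eval (RingHom.id 𝕂) a (Γ i j)) = CIS Γ) ∧
    (∀ G : Set (CIStmt N), IsGaussoid G →
      ((∃ Δ : Matrix N N (RatFunc 𝕂), Δ.IsSymm ∧ PrinReg Δ ∧ CIS Δ = G) ↔
       (∃ Δ : Matrix N N 𝕂, Δ.IsSymm ∧ PrinReg Δ ∧ CIS Δ = G))) := by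
  refine ⟨?_, ?_⟩
  · have h := Filter.eventually_cofinite.1 (main_ev 𝕂 Γ hsym hpr)
    refine ⟨h.toFinset, fun a ha => ?_⟩
    by_contra hc
    exact ha (h.mem_toFinset.2 hc)
  · intro G _
    constructor
    · rintro ⟨Δ, h1, h2, h3⟩
      obtain ⟨a, -, ha1, ha2, ha3⟩ := (main_ev 𝕂 Δ h1 h2).exists
      exact ⟨_, ha1, ha2, ha3.trans h3⟩
    · rintro ⟨Δ, h1, h2, h3⟩
      have inj : Function.Injective (RatFunc.C : 𝕂 →+* RatFunc 𝕂) := RingHom.injective _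
      have hp : ∀ S, pminor (Δ.map RatFunc.C) S = RatFunc.C (pminor Δ S) := fun S =>
        (RingHom.map_det (RatFunc.C : 𝕂 →+* RatFunc 𝕂) _).symm
      have hap : ∀ i j S, apminor (Δ.map RatFunc.C) i j S = RatFunc.C (apminor Δ i j S) :=
        fun i j S => (RingHom.map_det (RatFunc.C : 𝕂 →+* RatFunc 𝕂) _).symm
      refine ⟨Δ.map RatFunc.C, h1.map _, fun S hS => h2 S ?_, ?_⟩
      · rw [hp] at hS
        exact (map_eq_zero_iff _ inj).1 hS
      · rw [← h3]
        ext s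
        simp only [CIS, Set.mem_ofPred_eq, hap, map_eq_zero_iff _ inj]
end

section
/- Let 𝕂 be a linearly ordered field, N a finite set, and Γ a symmetric matrix indexed by N with entries in the field RatFunc 𝕂 of rational functions in one variable over 𝕂, such that the reduced denominator of every entry of Γ has nonzero constant term and the evaluation Γ(0) is positive definite over 𝕂 (all principal minors of Γ(0) are positive). Then Γ is principally regular over RatFunc 𝕂, and there exists a* > 0 in 𝕂 and a finite set F ⊆ 𝕂 such that for every a ∈ 𝕂 with 0 < a < a* and a ∉ F, the evaluation Γ(a) is defined, Γ(a) is positive definite over 𝕂, and CIS(Γ(a)) = CIS(Γ). -/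
open scoped symmDiff

variable {N : Type*} [DecidableEq N]

open Filter Topology in
theorem aux_poly_ne {𝕂 : Type*} [Field 𝕂] [LinearOrder 𝕂] [IsStrictOrderedRing 𝕂]
    [TopologicalSpace 𝕂] [OrderTopology 𝕂] (p : Polynomial 𝕂) (hp : p ≠ 0) :
    ∀ᶠ a in 𝓝[>] (0 : 𝕂), Polynomial.eval a p ≠ 0 := by
  have hf : (p.rootSet 𝕂 \ {0}).Finite := (p.rootSet_finite 𝕂).subset Set.sdiff_subset
  have h1 : ∀ᶠ a in 𝓝 (0 : 𝕂), a ∈ (p.rootSet 𝕂 \ {0})ᶜ :=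
    hf.isClosed.isOpen_compl.mem_nhds (by simp)
  filter_upwards [h1.filter_mono nhdsWithin_le_nhds, self_mem_nhdsWithin] with a ha h0 h
  apply ha
  refine ⟨?_, ne_of_gt h0⟩
  rw [Polynomial.mem_rootSet]
  exact ⟨hp, by simpa using h⟩

open Filter Topology in
theorem aux_poly_pos {𝕂 : Type*} [Field 𝕂] [LinearOrder 𝕂] [IsStrictOrderedRing 𝕂]
    [TopologicalSpace 𝕂] [OrderTopology 𝕂] (p : Polynomial 𝕂) (hp : 0 < p.eval 0) :
    ∀ᶠ a in 𝓝[>] (0 : 𝕂), 0 < Polynomial.eval a p :=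
  ((p.continuous.tendsto 0).eventually_const_lt hp).filter_mono nhdsWithin_le_nhds

/-- rational functions regular at `a` -/
def regAt {𝕂 : Type*} [Field 𝕂] (a : 𝕂) : Subring (RatFunc 𝕂) where
  carrier := {x | Polynomial.eval a x.denom ≠ 0}
  zero_mem' := by simp
  one_mem' := by simp
  add_mem' := by
    intro x y hx hy h
    have := Polynomial.eval_eq_zero_of_dvd_of_eval_eq_zero (RatFunc.denom_add_dvd x y) h
    rw [Polynomial.eval_mul] at this
    exact mul_ne_zero hx hy this
  mul_mem' := by
    intro x y hx hy h
    have := Polynomial.eval_eq_zero_of_dvd_of_eval_eq_zero (RatFunc.denom_mul_dvd x y) h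
    rw [Polynomial.eval_mul] at this
    exact mul_ne_zero hx hy this
  neg_mem' := by
    intro x hx h
    have h2 : (-x).denom ∣ x.denom := by
      have := RatFunc.denom_mul_dvd (RatFunc.C (-1)) x
      rw [RatFunc.denom_C, one_mul] at this
      simpa using this
    exact hx (Polynomial.eval_eq_zero_of_dvd_of_eval_eq_zero h2 h)

noncomputable def regEval {𝕂 : Type*} [Field 𝕂] (a : 𝕂) : regAt a →+* 𝕂 where
  toFun x := RatFunc.eval (RingHom.id 𝕂) a x
  map_zero' := by simp
  map_one' := by simp
  map_add' x y := RatFunc.eval_add (f := RingHom.id 𝕂) (a := a) x.2 y.2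
  map_mul' x y := RatFunc.eval_mul (f := RingHom.id 𝕂) (a := a) x.2 y.2

theorem aux_det {𝕂 : Type*} [Field 𝕂] (a : 𝕂) {n : Type*} [Fintype n] [DecidableEq n]
    (M : Matrix n n (RatFunc 𝕂)) (h : ∀ i j, Polynomial.eval a (M i j).denom ≠ 0) :
    Polynomial.eval a M.det.denom ≠ 0 ∧
    (Matrix.of fun i j => RatFunc.eval (RingHom.id 𝕂) a (M i j)).det
      = RatFunc.eval (RingHom.id 𝕂) a M.det := by
  let Mreg : Matrix n n (regAt a) := fun i j => ⟨M i j, h i j⟩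
  have h1 : ((Mreg.det : regAt a) : RatFunc 𝕂) = M.det := (regAt a).subtype.map_det Mreg
  have h2 : regEval a Mreg.det = _ := (regEval a).map_det Mreg
  rw [← h1]
  exact ⟨Mreg.det.2, h2.symm⟩

theorem aux_pminor {𝕂 : Type*} [Field 𝕂] (a : 𝕂) {N : Type*} [DecidableEq N]
    (M : Matrix N N (RatFunc 𝕂)) (h : ∀ i j, Polynomial.eval a (M i j).denom ≠ 0)
    (S : Finset N) :
    Polynomial.eval a (pminor M S).denom ≠ 0 ∧
    pminor (Matrix.of fun i j => RatFunc.eval (RingHom.id 𝕂) a (M i j)) S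
      = RatFunc.eval (RingHom.id 𝕂) a (pminor M S) :=
  aux_det a (M.submatrix (fun a : S => (a : N)) (fun a : S => (a : N))) fun _ _ => h _ _

theorem aux_apminor {𝕂 : Type*} [Field 𝕂] (a : 𝕂) {N : Type*} [DecidableEq N]
    (M : Matrix N N (RatFunc 𝕂)) (h : ∀ i j, Polynomial.eval a (M i j).denom ≠ 0)
    (i j : N) (K : Finset N) :
    Polynomial.eval a (apminor M i j K).denom ≠ 0 ∧
    apminor (Matrix.of fun i j => RatFunc.eval (RingHom.id 𝕂) a (M i j)) i j K
      = RatFunc.eval (RingHom.id 𝕂) a (apminor M i j K) :=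
  aux_det a (Matrix.of fun a b : Unit ⊕ ↥K =>
      M (Sum.elim (fun _ => i) (fun k => (k : N)) a)
        (Sum.elim (fun _ => j) (fun k => (k : N)) b)) fun _ _ => h _ _

theorem aux_eval {𝕂 : Type*} [Field 𝕂] (a : 𝕂) (g : RatFunc 𝕂) :
    RatFunc.eval (RingHom.id 𝕂) a g = Polynomial.eval a g.num / Polynomial.eval a g.denom := rfl

/-- a symmetric matrix of rational functions whose entries have no pole at 0
and whose evaluation at 0 is positive definite is principally regular, and its evaluations
at all sufficiently small positive points (finitely many exceptions) are positive definite
with the same CI structure. -/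
theorem stmt6 {N : Type*} [Fintype N] [DecidableEq N] (𝕂 : Type*) [Field 𝕂] [LinearOrder 𝕂] [IsStrictOrderedRing 𝕂]
    (Γ : Matrix N N (RatFunc 𝕂)) (hsym : Γ.IsSymm)
    (hden : ∀ i j : N, Polynomial.eval (0 : 𝕂) (Γ i j).denom ≠ 0)
    (hpos : PosDefMinors (Matrix.of fun i j => RatFunc.eval (RingHom.id 𝕂) 0 (Γ i j))) :
    PrinReg Γ ∧
    ∃ astar : 𝕂, 0 < astar ∧ ∃ F : Finset 𝕂,
      ∀ a : 𝕂, 0 < a → a < astar → a ∉ F →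
        (∀ i j : N, Polynomial.eval a (Γ i j).denom ≠ 0) ∧
        PosDefMinors (Matrix.of fun i j => RatFunc.eval (RingHom.id 𝕂) a (Γ i j)) ∧
        CIS (Matrix.of fun i j => RatFunc.eval (RingHom.id 𝕂) a (Γ i j)) = CIS Γ := by
  classical
  letI : TopologicalSpace 𝕂 := Preorder.topology 𝕂
  haveI : OrderTopology 𝕂 := ⟨rfl⟩
  have hp0 : ∀ S, 0 < RatFunc.eval (RingHom.id 𝕂) 0 (pminor Γ S) := fun S => by
    rw [← (aux_pminor 0 Γ hden S).2]; exact hpos S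
  refine ⟨fun S h => ?_, ?_⟩
  · have := hp0 S
    rw [h, RatFunc.eval_zero] at this
    exact lt_irrefl _ this
  have e1 : ∀ᶠ a in nhdsWithin (0 : 𝕂) (Set.Ioi 0),
      ∀ i j : N, Polynomial.eval a (Γ i j).denom ≠ 0 := by
    simp only [Filter.eventually_all]
    exact fun i j => aux_poly_ne _ (RatFunc.denom_ne_zero _)
  have e2 : ∀ᶠ a in nhdsWithin (0 : 𝕂) (Set.Ioi 0), ∀ S : Finset N,
      0 < Polynomial.eval a ((pminor Γ S).num * (pminor Γ S).denom) := by
    rw [Filter.eventually_all]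
    intro S
    apply aux_poly_pos
    have := hp0 S
    rw [aux_eval] at this
    rw [Polynomial.eval_mul]
    rcases div_pos_iff.1 this with h | h
    · exact mul_pos h.1 h.2
    · exact mul_pos_of_neg_of_neg h.1 h.2
  have e3 : ∀ᶠ a in nhdsWithin (0 : 𝕂) (Set.Ioi 0), ∀ (i j : N) (K : Finset N),
      apminor Γ i j K ≠ 0 → Polynomial.eval a (apminor Γ i j K).num ≠ 0 := by
    simp only [Filter.eventually_all]
    exact fun i j K h => aux_poly_ne _ (RatFunc.num_ne_zero h)
  obtain ⟨δ, hδ, hsub⟩ := mem_nhdsGT_iff_exists_Ioo_subset.1 (e1.and (e2.and e3))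
  refine ⟨δ, hδ, ∅, fun a h0 ha _ => ?_⟩
  obtain ⟨h1, h2, h3⟩ := hsub ⟨h0, ha⟩
  refine ⟨h1, fun S => ?_, ?_⟩
  · rw [(aux_pminor a Γ h1 S).2, aux_eval]
    have := h2 S
    rw [Polynomial.eval_mul] at this
    rcases mul_pos_iff.1 this with h | h
    · exact div_pos h.1 h.2
    · exact div_pos_of_neg_of_neg h.1 h.2
  · have key : ∀ i j K, apminor (Matrix.of fun i j => RatFunc.eval (RingHom.id 𝕂) a (Γ i j)) i j K = 0
        ↔ apminor Γ i j K = 0 := by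
      intro i j K
      obtain ⟨hd, he⟩ := aux_apminor a Γ h1 i j K
      rw [he]
      constructor
      · intro h
        by_contra hne
        rw [aux_eval] at h
        exact div_ne_zero (h3 i j K hne) hd h
      · intro h
        rw [h, RatFunc.eval_zero]
    ext s
    simp only [CIS, Set.mem_ofPred_eq, key]
end

section
/- Let 𝕂 be an infinite field and N, M disjoint finite sets. Let Σ be a principally regular symmetric matrix over 𝕂 indexed by N and Γ a principally regular symmetric matrix over 𝕂 indexed by M. Let G ⊔ H ⊆ A_{N∪M} be the set of all CI statements (ij|K') over N ∪ M such that either i, j ∈ N, K' ⊆ N and (ij|K') ∈ CIS(Σ), or i, j ∈ M, K' ⊆ M and (ij|K') ∈ CIS(Γ). Then there exists a principally regular symmetric matrix Φ over 𝕂 indexed by N ∪ M with CIS(Φ) = G ⊔ H. Moreover, if 𝕂 is linearly ordered, then for every ε > 0 in 𝕂 such a Φ can be chosen with every entry differing by less than ε from the corresponding entry of the block-diagonal matrix with diagonal blocks Σ and Γ (and zero off-diagonal blocks). -/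
open scoped symmDiff

variable {N : Type*} [DecidableEq N]

/-- The "direct sum" CI structure `G ⊔ H` on `Nt ⊕ Mt` of the CI structures of two
matrices indexed by `Nt` and `Mt`. -/
def dsumCI {Nt Mt R : Type*} [DecidableEq Nt] [DecidableEq Mt] [CommRing R]
    (S : Matrix Nt Nt R) (G : Matrix Mt Mt R) : Set (CIStmt (Nt ⊕ Mt)) :=
  {t | (∃ i j : Nt, ∃ K : Finset Nt,
          (s(i, j), K) ∈ CIS S ∧
          t = (s(Sum.inl i, Sum.inl j), K.map Function.Embedding.inl)) ∨
       (∃ i j : Mt, ∃ K : Finset Mt,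
          (s(i, j), K) ∈ CIS G ∧
          t = (s(Sum.inr i, Sum.inr j), K.map Function.Embedding.inr))}

universe u v w

namespace DS

theorem apminor_comm {n R : Type*} [DecidableEq n] [CommRing R] (M : Matrix n n R) (hM : M.IsSymm)
    (i j : n) (K : Finset n) : apminor M i j K = apminor M j i K := by
  unfold apminor
  rw [← Matrix.det_transpose]
  congr 1
  ext a b
  simp only [Matrix.transpose_apply, Matrix.of_apply]
  exact hM.apply _ _

theorem apminor_map {n R R' : Type*} [DecidableEq n] [CommRing R] [CommRing R'] (f : R →+* R')
    (M : Matrix n n R) (i j : n) (K : Finset n) :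
    apminor (M.map f) i j K = f (apminor M i j K) := by
  unfold apminor
  rw [RingHom.map_det]
  rfl

theorem pminor_map {n R R' : Type*} [DecidableEq n] [CommRing R] [CommRing R'] (f : R →+* R')
    (M : Matrix n n R) (K : Finset n) :
    pminor (M.map f) K = f (pminor M K) := by
  unfold pminor
  rw [RingHom.map_det]
  rfl

theorem apminor_eq {n R : Type*} [DecidableEq n] [CommRing R] (M : Matrix n n R)
    (i j : n) (K : Finset n) : apminor M i j K =
      (Matrix.of fun a b : Unit ⊕ K =>
        M (Sum.elim (fun _ => i) (fun k : K => k.1) a)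
          (Sum.elim (fun _ => j) (fun k : K => k.1) b)).det := by
  unfold apminor
  congr 1
  ext a b
  rcases a with a | a <;> rcases b with b | b <;> rfl

/-- a finset is equivalent to its image under an embedding -/
noncomputable def mapEquiv {n m : Type*} (f : n ↪ m) (K : Finset n) : K ≃ (K.map f : Finset m) :=
  Equiv.ofBijective (fun a => ⟨f a.1, Finset.mem_map_of_mem f a.2⟩) (by
    constructor
    · intro a b h
      exact Subtype.ext (f.injective (congrArg Subtype.val h))
    · rintro ⟨b, hb⟩
      obtain ⟨a, ha, rfl⟩ := Finset.mem_map.1 hb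
      exact ⟨⟨a, ha⟩, rfl⟩)

theorem apminor_submatrix {n m R : Type*} [DecidableEq n] [DecidableEq m] [CommRing R]
    (f : n ↪ m) (M : Matrix m m R) (i j : n) (K : Finset n) :
    apminor M (f i) (f j) (K.map f) = apminor (M.submatrix f f) i j K := by
  rw [apminor_eq, apminor_eq]
  rw [← Matrix.det_submatrix_equiv_self (Equiv.sumCongr (Equiv.refl Unit) (mapEquiv f K))]
  congr 1
  ext a b
  rcases a with a | a <;> rcases b with b | b <;> rfl

theorem mem_CIS {n R : Type*} [DecidableEq n] [CommRing R] (M : Matrix n n R) (hM : M.IsSymm)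
    (i j : n) (K : Finset n) :
    ((s(i, j), K) : CIStmt n) ∈ CIS M ↔ i ≠ j ∧ i ∉ K ∧ j ∉ K ∧ apminor M i j K = 0 := by
  simp only [CIS, CIStmt.proper, Set.mem_ofPred_eq, Sym2.mk_isDiag_iff, Sym2.mem_iff,
    forall_eq_or_imp, forall_eq, Sym2.eq_iff]
  constructor
  · rintro ⟨⟨h1, h2, h3⟩, h⟩
    exact ⟨h1, h2, h3, h i j (Or.inl ⟨rfl, rfl⟩)⟩
  · rintro ⟨h1, h2, h3, h⟩
    refine ⟨⟨h1, h2, h3⟩, ?_⟩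
    rintro a b (⟨rfl, rfl⟩ | ⟨rfl, rfl⟩)
    · exact h
    · rw [apminor_comm M hM]; exact h

/-- splitting of a finset of a sum type -/
def splitEquiv {n m : Type*} (A : Finset n) (B : Finset m) : (A ⊕ B) ≃ (A.disjSum B : Finset (n ⊕ m)) where
  toFun := Sum.elim (fun a => ⟨Sum.inl a.1, Finset.inl_mem_disjSum.2 a.2⟩)
    (fun b => ⟨Sum.inr b.1, Finset.inr_mem_disjSum.2 b.2⟩)
  invFun x := match x with
    | ⟨Sum.inl a, h⟩ => Sum.inl ⟨a, Finset.inl_mem_disjSum.1 h⟩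
    | ⟨Sum.inr b, h⟩ => Sum.inr ⟨b, Finset.inr_mem_disjSum.1 h⟩
  left_inv := by rintro (a | a) <;> rfl
  right_inv := by rintro ⟨a | a, h⟩ <;> rfl

section
variable {n m R : Type*} [DecidableEq n] [DecidableEq m] [CommRing R]

/-- the generic block matrix -/
def blk (S : Matrix n n R) (G : Matrix m m R) (X : Matrix n m R) : Matrix (n ⊕ m) (n ⊕ m) R :=
  Matrix.fromBlocks S X X.transpose G

theorem pminor_blk (S : Matrix n n R) (G : Matrix m m R) (A : Finset n) (B : Finset m) :
    pminor (blk S G 0) (A.disjSum B) = pminor S A * pminor G B := by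
  unfold pminor
  rw [← Matrix.det_submatrix_equiv_self (splitEquiv A B), ← Matrix.det_fromBlocks_zero₂₁ _ 0]
  congr 1
  ext a b
  rcases a with a | a <;> rcases b with b | b <;> simp [splitEquiv, blk]

theorem apminor_blk (S : Matrix n n R) (G : Matrix m m R) (X : Matrix n m R) (i j : n ⊕ m)
    (A : Finset n) (B : Finset m) :
    apminor (blk S G X) i j (A.disjSum B) =
      (Matrix.fromBlocks
        (Matrix.of fun a b : Unit ⊕ A => blk S G X (Sum.elim (fun _ => i) (fun k => Sum.inl k.1) a)
          (Sum.elim (fun _ => j) (fun k => Sum.inl k.1) b))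
        (Matrix.of fun (a : Unit ⊕ A) (b : B) =>
          blk S G X (Sum.elim (fun _ => i) (fun k => Sum.inl k.1) a) (Sum.inr b.1))
        (Matrix.of fun (a : B) (b : Unit ⊕ A) => blk S G X (Sum.inr a.1)
          (Sum.elim (fun _ => j) (fun k => Sum.inl k.1) b))
        (G.submatrix (fun a : B => a.1) (fun a : B => a.1))).det := by
  rw [apminor_eq]
  rw [← Matrix.det_submatrix_equiv_self
    ((Equiv.sumAssoc Unit A B).trans (Equiv.sumCongr (Equiv.refl Unit) (splitEquiv A B)))]
  congr 1
  ext a b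
  rcases a with (a | a) | a <;> rcases b with (b | b) | b <;> simp [splitEquiv, blk]

theorem apminor_mixed (S : Matrix n n R) (G : Matrix m m R) (i : n) (j : m)
    (A : Finset n) (B : Finset m) (hi : i ∉ A) (hj : j ∉ B) :
    apminor (blk S G (Matrix.single i j 1)) (Sum.inl i) (Sum.inr j) (A.disjSum B) =
      pminor S A * pminor G B := by
  rw [apminor_blk]
  have hB : (Matrix.of fun (a : Unit ⊕ A) (b : B) => blk S G (Matrix.single i j 1)
      (Sum.elim (fun _ => Sum.inl i) (fun k => Sum.inl k.1) a) (Sum.inr b.1)) = 0 := by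
    ext a ⟨b, hb⟩
    have hjb : j ≠ b := by rintro rfl; exact hj hb
    rcases a with a | ⟨a, ha⟩ <;> simp [blk, hjb]
  rw [hB, Matrix.det_fromBlocks_zero₁₂]
  congr 1
  have hA : (Matrix.of fun a b : Unit ⊕ A => blk S G (Matrix.single i j 1)
      (Sum.elim (fun _ => Sum.inl i) (fun k => Sum.inl k.1) a)
          (Sum.elim (fun _ => Sum.inr j) (fun k => Sum.inl k.1) b)) =
      Matrix.fromBlocks 1 (Matrix.of fun (_ : Unit) (b : A) => S i b) 0
        (S.submatrix (fun a : A => a.1) (fun a : A => a.1)) := by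
    ext a b
    rcases a with a | ⟨a, ha⟩ <;> rcases b with b | ⟨b, hb⟩
    · simp [blk]
    · simp [blk]
    · have hia : i ≠ a := by rintro rfl; exact hi ha
      simp [blk, hia]
    · simp [blk]
  rw [hA, Matrix.det_fromBlocks_zero₂₁]
  simp [pminor]

end

theorem apminor_same {n m F : Type*} [DecidableEq n] [DecidableEq m] [Field F]
    (S : Matrix n n F) (G : Matrix m m F) (i j : n) (hij : i ≠ j) (k : m)
    (A : Finset n) (B : Finset m) (hi : i ∉ A) (hj : j ∉ A) (hk : k ∈ B)
    (hS : pminor S A ≠ 0) (hG : pminor G B ≠ 0) :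
    ∃ X, apminor (blk S G X) (Sum.inl i) (Sum.inl j) (A.disjSum B) ≠ 0 := by
  set D := S.submatrix (fun a : A => a.1) (fun a : A => a.1) with hD
  set u : Matrix Unit A F := Matrix.of fun _ b => S i b with hu
  set v : Matrix A Unit F := Matrix.of fun a _ => S a j with hv
  obtain ⟨t, ht⟩ : ∃ t : F, (Matrix.fromBlocks (Matrix.of fun _ _ : Unit => S i j - t) u v D).det ≠ 0 := by
    have hDu : IsUnit D.det := isUnit_iff_ne_zero.2 hS
    let _ := D.invertibleOfIsUnitDet hDu
    refine ⟨S i j - 1 - (u * ⅟D * v) () (), ?_⟩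
    rw [Matrix.det_fromBlocks₂₂]
    refine mul_ne_zero hS ?_
    rw [Matrix.det_unique]
    simp only [Matrix.sub_apply, Matrix.of_apply]
    have hu0 : (default : Unit) = () := rfl
    rw [hu0]
    ring_nf
    exact one_ne_zero
  let X : Matrix n m F := Matrix.of fun a b => if a = i then t * G k b else if a = j then (if k = b then 1 else 0) else 0
  let E : Matrix (Unit ⊕ A) B F := Matrix.single (Sum.inl ()) ⟨k, hk⟩ t
  refine ⟨X, ?_⟩
  rw [apminor_blk]
  set Am := (Matrix.of fun a b : Unit ⊕ A => blk S G X
      (Sum.elim (fun _ => Sum.inl i) (fun k => Sum.inl k.1) a)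
          (Sum.elim (fun _ => Sum.inl j) (fun k => Sum.inl k.1) b)) with hAm
  set Cm := (Matrix.of fun (a : B) (b : Unit ⊕ A) => blk S G X (Sum.inr a.1)
          (Sum.elim (fun _ => Sum.inl j) (fun k => Sum.inl k.1) b)) with hCm
  set Dm := (G.submatrix (fun a : B => a.1) (fun a : B => a.1)) with hDm
  have hBm : (Matrix.of fun (a : Unit ⊕ A) (b : B) =>
          blk S G X (Sum.elim (fun _ => Sum.inl i) (fun k => Sum.inl k.1) a) (Sum.inr b.1)) = E * Dm := by
    ext a ⟨b, hb⟩
    rcases a with a | ⟨a, ha⟩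
    · simp [blk, E, X, Dm]
    · have hia : a ≠ i := by rintro rfl; exact hi ha
      have hja : a ≠ j := by rintro rfl; exact hj ha
      simp [blk, E, X, hia, hja]
  have hEC : Am - E * Cm = Matrix.fromBlocks (Matrix.of fun _ _ : Unit => S i j - t) u v D := by
    ext a b
    rcases a with a | ⟨a, ha⟩ <;> rcases b with b | ⟨b, hb⟩
    · simp [Am, Cm, E, blk, X, hij.symm]
    · have hib : b ≠ i := by rintro rfl; exact hi hb
      have hjb : b ≠ j := by rintro rfl; exact hj hb
      simp [Am, Cm, E, blk, X, hib, hjb, u]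
    · simp [Am, Cm, E, blk, v]
    · simp [Am, Cm, E, blk, D]
  have key : Matrix.fromBlocks Am (E * Dm) Cm Dm =
      Matrix.fromBlocks 1 E 0 1 * Matrix.fromBlocks (Am - E * Cm) 0 Cm Dm := by
    rw [Matrix.fromBlocks_multiply]; simp
  rw [hBm, key, Matrix.det_mul, Matrix.det_fromBlocks_zero₂₁, Matrix.det_fromBlocks_zero₁₂, hEC]
  simp only [Matrix.det_one, one_mul]
  exact mul_ne_zero ht hG

theorem exists_eval {σ ι F : Type*} [Field F] [Fintype ι] (T : Set F)
    (hT : T.Infinite) (p : ι → MvPolynomial σ F) (hp : ∀ i, p i ≠ 0) :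
    ∃ x : σ → F, (∀ s, x s ∈ T) ∧ ∀ i, MvPolynomial.eval x (p i) ≠ 0 := by
  have h : ∏ i, p i ≠ 0 := Finset.prod_ne_zero_iff.2 fun i _ => hp i
  by_contra! hc
  apply h
  refine MvPolynomial.funext_set (fun _ => T) (fun _ => hT) ?_
  intro x hx
  obtain ⟨i, hi⟩ := hc x (fun s => hx s (Set.mem_univ _))
  rw [map_prod, map_zero]
  exact Finset.prod_eq_zero (Finset.mem_univ i) hi

theorem blk_symm {n m R : Type*} {S : Matrix n n R} {G : Matrix m m R}
    (hS : S.IsSymm) (hG : G.IsSymm) (X : Matrix n m R) : (blk S G X).IsSymm :=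
  Matrix.IsSymm.fromBlocks hS rfl hG

theorem blk_swap {n m R : Type*} [DecidableEq n] [DecidableEq m] [CommRing R]
    (S : Matrix n n R) (G : Matrix m m R) (X : Matrix n m R)
    (i j : n ⊕ m) (K : Finset (n ⊕ m)) :
    apminor (blk S G X) i j K = apminor (blk G S X.transpose) i.swap j.swap
      (K.map (Equiv.sumComm n m).toEmbedding) := by
  have := apminor_submatrix (Equiv.sumComm n m).toEmbedding (blk G S X.transpose) i j K
  simp only [Equiv.coe_toEmbedding, Equiv.sumComm_apply] at this
  rw [this]
  congr 1
  ext a b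
  rcases a with a | a <;> rcases b with b | b <;> simp [blk]

theorem split {n m : Type*} (K : Finset (n ⊕ m)) : K = K.toLeft.disjSum K.toRight :=
  (Finset.toLeft_disjSum_toRight).symm

/-- the statements outside the sum -/
def bad {n m : Type*} (i j : n ⊕ m) (K : Finset (n ⊕ m)) : Prop :=
  i ≠ j ∧ i ∉ K ∧ j ∉ K ∧ ¬ ((∃ a b : n, ∃ L : Finset n, i = Sum.inl a ∧ j = Sum.inl b ∧
      K = L.map Function.Embedding.inl) ∨ (∃ a b : m, ∃ L : Finset m, i = Sum.inr a ∧ j = Sum.inr b ∧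
      K = L.map Function.Embedding.inr))

theorem bad_exists {n m F : Type*} [DecidableEq n] [DecidableEq m] [Field F]
    (S : Matrix n n F) (G : Matrix m m F) (hS : S.IsSymm) (hG : G.IsSymm)
    (hS' : PrinReg S) (hG' : PrinReg G) (i j : n ⊕ m) (K : Finset (n ⊕ m)) (h : bad i j K) :
    ∃ X, apminor (blk S G X) i j K ≠ 0 := by
  obtain ⟨hij, hi, hj, hb⟩ := h
  rcases i with i | i <;> rcases j with j | j
  · have hne : K.toRight.Nonempty := by
      by_contra hc
      rw [Finset.not_nonempty_iff_eq_empty] at hc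
      refine hb (Or.inl ⟨i, j, K.toLeft, rfl, rfl, ?_⟩)
      conv_lhs => rw [split K, hc]
      simp
    obtain ⟨k, hk⟩ := hne
    have := apminor_same S G i j (fun h => hij (by rw [h])) k K.toLeft K.toRight
      (by simpa using hi) (by simpa using hj) hk (hS' _) (hG' _)
    rwa [← split] at this
  · refine ⟨Matrix.single i j 1, ?_⟩
    rw [split K, apminor_mixed S G i j _ _ (by simpa using hi) (by simpa using hj)]
    exact mul_ne_zero (hS' _) (hG' _)
  · refine ⟨Matrix.single j i 1, ?_⟩
    rw [apminor_comm _ (blk_symm hS hG _), split K,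
      apminor_mixed S G j i _ _ (by simpa using hj) (by simpa using hi)]
    exact mul_ne_zero (hS' _) (hG' _)
  · have hne : K.toLeft.Nonempty := by
      by_contra hc
      rw [Finset.not_nonempty_iff_eq_empty] at hc
      refine hb (Or.inr ⟨i, j, K.toRight, rfl, rfl, ?_⟩)
      conv_lhs => rw [split K, hc]
      simp
    obtain ⟨k, hk⟩ := hne
    obtain ⟨X, hX⟩ := apminor_same G S i j (fun h => hij (by rw [h])) k K.toRight K.toLeft
      (by simpa using hi) (by simpa using hj) hk (hG' _) (hS' _)
    refine ⟨X.transpose, ?_⟩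
    rw [blk_swap, Matrix.transpose_transpose]
    have hK : K.map (Equiv.sumComm n m).toEmbedding = K.toRight.disjSum K.toLeft := by
      ext a
      rcases a with a | a <;> simp
    rw [hK]
    exact hX

theorem main {n m F : Type*} [Fintype n] [Fintype m] [DecidableEq n] [DecidableEq m] [Field F]
    (T : Set F) (hT : T.Infinite)
    (S : Matrix n n F) (G : Matrix m m F) (hS : S.IsSymm) (hS' : PrinReg S) (hG : G.IsSymm)
    (hG' : PrinReg G) :
    ∃ X : Matrix n m F, (∀ a b, X a b ∈ T) ∧ (blk S G X).IsSymm ∧ PrinReg (blk S G X) ∧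
      CIS (blk S G X) = dsumCI S G := by
  classical
  let P : Matrix (n ⊕ m) (n ⊕ m) (MvPolynomial (n × m) F) :=
    blk (S.map MvPolynomial.C) (G.map MvPolynomial.C) (Matrix.of fun a b => MvPolynomial.X (a, b))
  have hP : ∀ X : n × m → F, P.map (MvPolynomial.eval X) = blk S G (Matrix.of fun a b => X (a, b)) := by
    intro X
    ext a b
    rcases a with a | a <;> rcases b with b | b <;> simp [P, blk]
  let ι := Finset (n ⊕ m) ⊕ {q : (n ⊕ m) × (n ⊕ m) × Finset (n ⊕ m) // bad q.1 q.2.1 q.2.2}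
  haveI : Fintype ι := Fintype.ofFinite _
  let p : ι → MvPolynomial (n × m) F := Sum.elim (fun U => pminor P U)
    (fun q => apminor P q.1.1 q.1.2.1 q.1.2.2)
  have hp : ∀ i, p i ≠ 0 := by
    rintro (U | ⟨⟨i, j, K⟩, hb⟩) h0
    · have h1 : MvPolynomial.eval (fun _ => (0 : F)) (pminor P U) = 0 := by
        have : pminor P U = 0 := h0
        rw [this, map_zero]
      rw [← pminor_map, hP, split U] at h1
      have h2 : (Matrix.of fun (_ : n) (_ : m) => (0 : F)) = 0 := rfl
      rw [h2, pminor_blk] at h1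
      exact mul_ne_zero (hS' _) (hG' _) h1
    · obtain ⟨X, hX⟩ := bad_exists S G hS hG hS' hG' i j K hb
      have h1 : MvPolynomial.eval (fun q => X q.1 q.2) (apminor P i j K) = 0 := by
        have : apminor P i j K = 0 := h0
        rw [this, map_zero]
      rw [← apminor_map, hP] at h1
      exact hX h1
  obtain ⟨x, hxT, hx⟩ := exists_eval T hT p hp
  set X : Matrix n m F := Matrix.of fun a b => x (a, b) with hXdef
  have hsym := blk_symm hS hG X
  have hbad : ∀ i j K, bad i j K → apminor (blk S G X) i j K ≠ 0 := by
    intro i j K hb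
    have := hx (Sum.inr ⟨(i, j, K), hb⟩)
    change MvPolynomial.eval x (apminor P i j K) ≠ 0 at this
    rwa [← apminor_map, hP] at this
  have hl : ∀ a b L, apminor (blk S G X) (Sum.inl a) (Sum.inl b) (L.map Function.Embedding.inl)
      = apminor S a b L := fun a b L =>
    apminor_submatrix Function.Embedding.inl (blk S G X) a b L
  have hr : ∀ a b L, apminor (blk S G X) (Sum.inr a) (Sum.inr b) (L.map Function.Embedding.inr)
      = apminor G a b L := fun a b L =>
    apminor_submatrix Function.Embedding.inr (blk S G X) a b L
  refine ⟨X, fun a b => hxT _, hsym, ?_, ?_⟩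
  · intro U
    have := hx (Sum.inl U)
    change MvPolynomial.eval x (pminor P U) ≠ 0 at this
    rwa [← pminor_map, hP] at this
  · ext ⟨q, K⟩
    induction q using Sym2.ind with
    | _ i j =>
    constructor
    · intro h
      rw [mem_CIS _ hsym] at h
      obtain ⟨hij, hi, hj, h0⟩ := h
      by_contra hc
      refine hbad i j K ⟨hij, hi, hj, ?_⟩ h0
      rintro (⟨a, b, L, rfl, rfl, rfl⟩ | ⟨a, b, L, rfl, rfl, rfl⟩)
      · refine hc (Or.inl ⟨a, b, L, (mem_CIS _ hS _ _ _).2 ⟨?_, ?_, ?_, ?_⟩, rfl⟩)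
        · simpa using hij
        · simpa using hi
        · simpa using hj
        · rw [← hl]; exact h0
      · refine hc (Or.inr ⟨a, b, L, (mem_CIS _ hG _ _ _).2 ⟨?_, ?_, ?_, ?_⟩, rfl⟩)
        · simpa using hij
        · simpa using hi
        · simpa using hj
        · rw [← hr]; exact h0
    · rintro (⟨a, b, L, h, e⟩ | ⟨a, b, L, h, e⟩)
      · rw [e, mem_CIS _ hsym]
        rw [mem_CIS _ hS] at h
        rw [hl]
        simpa using h
      · rw [e, mem_CIS _ hsym]
        rw [mem_CIS _ hG] at h
        rw [hr]
        simpa using h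

end DS

/-- the dependent sum of two algebraic Gaussians is an algebraic Gaussian
on the disjoint union of the ground sets; over an ordered field the realization can be
chosen entrywise arbitrarily close to the block-diagonal matrix. -/
theorem stmt7 :
    (∀ (𝕂 : Type u) [Field 𝕂] [Infinite 𝕂],
     ∀ (Nt : Type v) (Mt : Type w) [Fintype Nt] [DecidableEq Nt] [Fintype Mt] [DecidableEq Mt]
       (S : Matrix Nt Nt 𝕂) (G : Matrix Mt Mt 𝕂),
       S.IsSymm → PrinReg S → G.IsSymm → PrinReg G →
       ∃ Φ : Matrix (Nt ⊕ Mt) (Nt ⊕ Mt) 𝕂,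
         Φ.IsSymm ∧ PrinReg Φ ∧ CIS Φ = dsumCI S G) ∧
    (∀ (𝕂 : Type u) [Field 𝕂] [LinearOrder 𝕂] [IsStrictOrderedRing 𝕂],
     ∀ (Nt : Type v) (Mt : Type w) [Fintype Nt] [DecidableEq Nt] [Fintype Mt] [DecidableEq Mt]
       (S : Matrix Nt Nt 𝕂) (G : Matrix Mt Mt 𝕂),
       S.IsSymm → PrinReg S → G.IsSymm → PrinReg G →
       ∀ ε : 𝕂, 0 < ε →
         ∃ Φ : Matrix (Nt ⊕ Mt) (Nt ⊕ Mt) 𝕂,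
           Φ.IsSymm ∧ PrinReg Φ ∧ CIS Φ = dsumCI S G ∧
           ∀ a b : Nt ⊕ Mt, |Φ a b - Matrix.fromBlocks S 0 0 G a b| < ε) := by
  refine ⟨?_, ?_⟩
  · intro 𝕂 _ _ Nt Mt _ _ _ _ S G hS hS' hG hG'
    obtain ⟨X, -, h⟩ := DS.main Set.univ Set.infinite_univ S G hS hS' hG hG'
    exact ⟨_, h⟩
  · intro 𝕂 _ _ _ Nt Mt _ _ _ _ S G hS hS' hG hG' ε hε
    obtain ⟨X, hX, h1, h2, h3⟩ := DS.main (Set.Ioo (-ε) ε) (Set.Ioo_infinite (by linarith))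
      S G hS hS' hG hG'
    refine ⟨_, h1, h2, h3, ?_⟩
    rintro (a | a) (b | b)
    · simpa [DS.blk] using hε
    · simpa [DS.blk, abs_lt] using hX a b
    · simpa [DS.blk, abs_lt] using hX b a
    · simpa [DS.blk] using hε
end

section
/- Let 𝕂 be an infinite field, N a finite set, Γ a principally regular symmetric matrix over 𝕂 indexed by N with G = CIS(Γ), and let L be a finite set disjoint from N. Then the set {(ij|K') ∈ A_{N∪L} : i, j ∈ N, K' ⊆ N∖{i,j}, (ij|K') ∈ G} is algebraically realizable over 𝕂, i.e. equals CIS(Φ) for some principally regular symmetric matrix Φ over 𝕂 indexed by N ∪ L. Moreover, if 𝕂 is linearly ordered, then for every principally regular symmetric matrix Λ over 𝕂 indexed by L and every ε > 0 in 𝕂, such a Φ can be chosen with every entry differing by less than ε from the corresponding entry of the block-diagonal matrix with diagonal blocks Γ and Λ. -/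
open scoped symmDiff

variable {N : Type*} [DecidableEq N]

/-- The embedding of a CI structure on `Nt` into the ground set `Nt ⊕ Lt`
(conditioning sets stay inside `Nt`). -/
def embedCI {Nt Lt : Type*} (G : Set (CIStmt Nt)) : Set (CIStmt (Nt ⊕ Lt)) :=
  {t | ∃ i j : Nt, ∃ K : Finset Nt,
        (s(i, j), K) ∈ G ∧ t = (s(Sum.inl i, Sum.inl j), K.map Function.Embedding.inl)}

/-- The matrix with first block `Γ` and all other entries given by `x`. -/
def extMat {Nt Lt R : Type*} (Γ : Matrix Nt Nt R) (x : Sym2 (Nt ⊕ Lt) → R) :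
    Matrix (Nt ⊕ Lt) (Nt ⊕ Lt) R
  | Sum.inl i, Sum.inl j => Γ i j
  | a, b => x s(a, b)

lemma extMat_symm {Nt Lt R : Type*} (Γ : Matrix Nt Nt R) (h : Γ.IsSymm)
    (x : Sym2 (Nt ⊕ Lt) → R) : (extMat Γ x).IsSymm := by
  ext a b
  rcases a with a | a <;> rcases b with b | b <;>
    simp [extMat, Matrix.transpose_apply, Sym2.eq_swap, h.apply]

lemma pminor_map {M R S : Type*} [DecidableEq M] [CommRing R] [CommRing S] (f : R →+* S)
    (A : Matrix M M R) (K : Finset M) : f (pminor A K) = pminor (A.map f) K := by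
  unfold pminor
  rw [RingHom.map_det]
  rfl

lemma apminor_map {M R S : Type*} [DecidableEq M] [CommRing R] [CommRing S] (f : R →+* S)
    (A : Matrix M M R) (i j : M) (K : Finset M) :
    f (apminor A i j K) = apminor (A.map f) i j K := by
  unfold apminor
  rw [RingHom.map_det]
  rfl

lemma apminor_inl {Nt Lt R : Type*} [DecidableEq Nt] [DecidableEq Lt] [CommRing R]
    (Γ : Matrix Nt Nt R) (x : Sym2 (Nt ⊕ Lt) → R) (i j : Nt) (K : Finset Nt) :
    apminor (extMat Γ x) (Sum.inl i) (Sum.inl j) (K.map Function.Embedding.inl)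
      = apminor Γ i j K := by
  unfold apminor
  let e : K ≃ (K.map (Function.Embedding.inl : Nt ↪ Nt ⊕ Lt)) :=
    { toFun := fun a => ⟨Sum.inl a.1, Finset.mem_map_of_mem Function.Embedding.inl a.2⟩
      invFun := fun a => ⟨a.1.getLeft (by
        obtain ⟨b, _, hb⟩ := Finset.mem_map.mp a.2
        rw [← hb]; rfl), by
        obtain ⟨b, hb', hb⟩ := Finset.mem_map.mp a.2
        simp only [← hb]
        exact hb'⟩
      left_inv := by intro a; simp
      right_inv := by intro a; simp }
  rw [← Matrix.det_submatrix_equiv_self (Equiv.sumCongr (Equiv.refl Unit) e)]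
  congr 1
  ext a b
  rcases a with a | a <;> rcases b with b | b <;> rfl

/-- Principal minors of `Γ ⊕ 1` do not vanish. -/
lemma pminor_ext_ne {Nt Lt R : Type*} [DecidableEq Nt] [DecidableEq Lt] [Field R]
    (Γ : Matrix Nt Nt R) (hΓ : PrinReg Γ) (x : Sym2 (Nt ⊕ Lt) → R) (S : Finset (Nt ⊕ Lt))
    (h1 : ∀ a : Lt, Sum.inr a ∈ S → x s(Sum.inr a, Sum.inr a) = 1)
    (h0 : ∀ a ∈ S, ∀ b ∈ S, a ≠ b → x s(a, b) = 0) :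
    pminor (extMat Γ x) S ≠ 0 := by
  unfold pminor
  rw [Matrix.twoBlockTriangular_det _ (fun a : S => a.1.isLeft = true)]
  · apply mul_ne_zero
    · let e : S.toLeft ≃ {a : S // a.1.isLeft = true} :=
        { toFun := fun a => ⟨⟨Sum.inl a.1, Finset.mem_toLeft.mp a.2⟩, rfl⟩
          invFun := fun a => ⟨a.1.1.getLeft a.2, by simp⟩
          left_inv := by intro a; simp
          right_inv := by intro a; simp }
      rw [← Matrix.det_submatrix_equiv_self e]
      exact hΓ S.toLeft
    · have : Matrix.toSquareBlockProp ((extMat Γ x).submatrix (fun a : S => (a : Nt ⊕ Lt))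
          (fun a : S => (a : Nt ⊕ Lt))) (fun a : S => ¬ a.1.isLeft = true) = 1 := by
        ext ⟨⟨a, ha⟩, ha'⟩ ⟨⟨b, hb⟩, hb'⟩
        rcases a with a | a
        · simp at ha'
        rcases b with b | b
        · simp at hb'
        by_cases hab : a = b
        · subst hab
          simp [Matrix.toSquareBlockProp, extMat, h1 a ha]
        · have := h0 _ ha _ hb (by simpa using hab)
          simp [Matrix.toSquareBlockProp, extMat, Matrix.one_apply, hab, this]
      rw [this]
      simp
  · rintro ⟨a, ha⟩ ha' ⟨b, hb⟩ hb'
    rcases a with a | a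
    · simp at ha'
    rcases b with b | b
    · simpa [extMat] using h0 _ ha _ hb (by simp)
    · simp at hb'

lemma exists_schur {κ R : Type*} [Fintype κ] [DecidableEq κ] [Field R]
    (D : Matrix κ κ R) (hD : D.det ≠ 0) (l : κ)
    (hrow : ∀ k, D l k = if k = l then 1 else 0)
    (hcol : ∀ k, D k l = if k = l then 1 else 0)
    (a : R) (r c : κ → R) (hc : c l = 0) :
    ∃ t : R, (Matrix.fromBlocks (Matrix.of fun _ _ : Unit => a)
      (Matrix.of fun (_ : Unit) k => r k + if k = l then t else 0)
      (Matrix.of fun k (_ : Unit) => c k + if k = l then 1 else 0) D).det ≠ 0 := by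
  have hu : IsUnit D.det := isUnit_iff_ne_zero.mpr hD
  letI : Invertible D := Matrix.invertibleOfIsUnitDet D hu
  set f : κ → R := D⁻¹.mulVec c with hf
  have hDf : D.mulVec f = c := by
    rw [hf, Matrix.mulVec_mulVec, Matrix.mul_nonsing_inv _ hu, Matrix.one_mulVec]
  have hfl : f l = 0 := by
    have := congrFun hDf l
    rw [hc] at this
    simpa [Matrix.mulVec, dotProduct, hrow] using this
  have hDs : D.mulVec (fun k => if k = l then 1 else 0) = (fun k => if k = l then (1 : R) else 0) := by
    ext k
    simp [Matrix.mulVec, dotProduct, hcol]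
  have hDs' : D⁻¹.mulVec (fun k => if k = l then 1 else 0)
      = (fun k => if k = l then (1 : R) else 0) := by
    conv_lhs => rw [← hDs]
    rw [Matrix.mulVec_mulVec, Matrix.nonsing_inv_mul _ hu, Matrix.one_mulVec]
  have key : D⁻¹.mulVec (fun k => c k + if k = l then 1 else 0)
      = fun k => f k + if k = l then 1 else 0 := by
    have : (fun k => c k + if k = l then (1 : R) else 0)
      = c + (fun k => if k = l then (1 : R) else 0) := rfl
    rw [this, Matrix.mulVec_add, hDs']
    rfl
  refine ⟨a - (∑ k, r k * f k + r l) - 1, ?_⟩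
  set t := a - (∑ k, r k * f k + r l) - 1 with ht
  rw [Matrix.det_fromBlocks₂₂]
  refine mul_ne_zero hD ?_
  rw [Matrix.det_unique, Matrix.invOf_eq_nonsing_inv, Matrix.mul_assoc]
  have h2 : ∀ k u, (D⁻¹ * (Matrix.of fun k (_ : Unit) => c k + if k = l then (1 : R) else 0)) k u
      = f k + if k = l then 1 else 0 := by
    intro k u
    exact congrFun key k
  rw [Matrix.sub_apply, Matrix.mul_apply]
  simp only [h2, Matrix.of_apply]
  have : ∑ k, (r k + if k = l then t else 0) * (f k + if k = l then 1 else 0)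
      = ∑ k, r k * f k + r l + t * (f l + 1) := by
    simp [add_mul, mul_add, Finset.sum_add_distrib]
    ring
  rw [this, hfl, ht]
  ring_nf
  exact one_ne_zero

/-- A non-degenerate statement which is not contained in the first block. -/
def BadStmt {Nt Lt : Type*} (i j : Nt ⊕ Lt) (K : Finset (Nt ⊕ Lt)) : Prop :=
  i ≠ j ∧ i ∉ K ∧ j ∉ K ∧ (i.isRight ∨ j.isRight ∨ ∃ l : Lt, Sum.inr l ∈ K)

lemma apminor_eq_fromBlocks {M R : Type*} [DecidableEq M] [CommRing R] (A : Matrix M M R)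
    (i j : M) (K : Finset M) :
    apminor A i j K = (Matrix.fromBlocks (Matrix.of fun _ _ : Unit => A i j)
      (Matrix.of fun (_ : Unit) (k : K) => A i k)
      (Matrix.of fun (k : K) (_ : Unit) => A k j)
      (A.submatrix (fun a : K => (a : M)) (fun a : K => (a : M)))).det := by
  unfold apminor
  congr 1
  ext a b
  rcases a with a | a <;> rcases b with b | b <;> rfl

lemma exists_apminor_ne {Nt Lt R : Type*} [DecidableEq Nt] [DecidableEq Lt] [Field R]
    (Γ : Matrix Nt Nt R) (hΓ : PrinReg Γ) (i j : Nt ⊕ Lt) (K : Finset (Nt ⊕ Lt))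
    (h : BadStmt i j K) : ∃ x : Sym2 (Nt ⊕ Lt) → R, apminor (extMat Γ x) i j K ≠ 0 := by
  classical
  obtain ⟨hij, hi, hj, h⟩ := h
  by_cases hr : i.isRight ∨ j.isRight
  · let x : Sym2 (Nt ⊕ Lt) → R := fun e => if e.IsDiag ∨ e = s(i, j) then 1 else 0
    refine ⟨x, ?_⟩
    have hp : pminor (extMat Γ x) K ≠ 0 := by
      apply pminor_ext_ne Γ hΓ
      · intro a _
        simp [x]
      · intro a ha b hb hab
        have h1 : a ≠ i := fun h => hi (h ▸ ha)
        have h2 : a ≠ j := fun h => hj (h ▸ ha)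
        simp [x, hab, h1, h2]
    have hone : extMat Γ x i j = 1 := by
      rcases i with i | i <;> rcases j with j | j <;> simp [extMat, x] at hr ⊢
    rw [apminor_eq_fromBlocks, hone]
    rcases i with i | i
    · rcases j with j | j
      · simp at hr
      have : (Matrix.of fun (k : K) (_ : Unit) => extMat Γ x k (Sum.inr j)) = 0 := by
        ext ⟨k, hk⟩ _
        have h1 : k ≠ Sum.inl i := fun h => hi (h ▸ hk)
        have h2 : k ≠ Sum.inr j := fun h => hj (h ▸ hk)
        have : x s(k, Sum.inr j) = 0 := by simp [x, h1, h2]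
        rcases k with k | k <;> simpa [extMat] using this
      rw [this, Matrix.det_fromBlocks_zero₂₁]
      refine mul_ne_zero (by simp) hp
    · have : (Matrix.of fun (_ : Unit) (k : K) => extMat Γ x (Sum.inr i) k) = 0 := by
        ext _ ⟨k, hk⟩
        have h1 : k ≠ Sum.inr i := fun h => hi (h ▸ hk)
        have h2 : k ≠ j := fun h => hj (h ▸ hk)
        have : x s(Sum.inr i, k) = 0 := by simp [x, h1, h1.symm, h2]
        rcases k with k | k <;> simpa [extMat] using this
      rw [this, Matrix.det_fromBlocks_zero₁₂]
      refine mul_ne_zero (by simp) hp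
  · obtain ⟨l, hl⟩ : ∃ l : Lt, Sum.inr l ∈ K := by tauto
    rcases i with i | i
    swap
    · simp at hr
    rcases j with j | j
    swap
    · simp at hr
    clear hr h
    let x : R → Sym2 (Nt ⊕ Lt) → R := fun t e =>
      if e.IsDiag then 1 else if e = s(Sum.inl i, Sum.inr l) then t else
      if e = s(Sum.inl j, Sum.inr l) then 1 else 0
    have hx1 : ∀ t a, x t s(a, a) = 1 := by intro t a; simp [x]
    have hx0 : ∀ t, ∀ a ∈ K, ∀ b ∈ K, a ≠ b → x t s(a, b) = 0 := by
      intro t a ha b hb hab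
      have h1 : a ≠ Sum.inl i := fun h => hi (h ▸ ha)
      have h2 : a ≠ Sum.inl j := fun h => hj (h ▸ ha)
      have h3 : b ≠ Sum.inl i := fun h => hi (h ▸ hb)
      have h4 : b ≠ Sum.inl j := fun h => hj (h ▸ hb)
      simp [x, hab, h1, h2, h3, h4]
    have hDt : ∀ t, (extMat Γ (x t)).submatrix (fun a : K => (a : Nt ⊕ Lt))
        (fun a : K => (a : Nt ⊕ Lt)) = (extMat Γ (x 0)).submatrix (fun a : K => (a : Nt ⊕ Lt))
        (fun a : K => (a : Nt ⊕ Lt)) := by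
      intro t
      ext ⟨a, ha⟩ ⟨b, hb⟩
      have : x t s(a, b) = x 0 s(a, b) := by
        by_cases hab : a = b
        · subst hab; rw [hx1, hx1]
        · rw [hx0 t a ha b hb hab, hx0 0 a ha b hb hab]
      rcases a with a | a <;> rcases b with b | b <;> simp [extMat, this]
    have hp : pminor (extMat Γ (x 0)) K ≠ 0 :=
      pminor_ext_ne Γ hΓ _ _ (fun a _ => hx1 _ _) (hx0 0)
    have hij' : i ≠ j := fun h => hij (by rw [h])
    obtain ⟨t, ht⟩ := exists_schur _ hp ⟨Sum.inr l, hl⟩ (by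
        rintro ⟨k, hk⟩
        by_cases hkl : k = Sum.inr l
        · subst hkl
          simp [extMat, hx1]
        · have := hx0 0 _ hl _ hk (Ne.symm hkl)
          simpa [extMat, hkl] using this) (by
        rintro ⟨k, hk⟩
        by_cases hkl : k = Sum.inr l
        · subst hkl
          simp [extMat, hx1]
        · have := hx0 0 _ hk _ hl hkl
          rcases k with k | k <;> simpa [extMat, hkl] using this)
      (Γ i j) (fun k => extMat Γ (fun _ => 0) (Sum.inl i) (k : Nt ⊕ Lt))
      (fun k => extMat Γ (fun _ => 0) (k : Nt ⊕ Lt) (Sum.inl j)) (by simp [extMat])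
    refine ⟨x t, ?_⟩
    rw [apminor_eq_fromBlocks, hDt]
    have e1 : (Matrix.of fun (_ : Unit) (k : K) => extMat Γ (x t) (Sum.inl i) k)
        = Matrix.of fun (_ : Unit) (k : K) => extMat Γ (fun _ => 0) (Sum.inl i) (k : Nt ⊕ Lt) +
          if k = ⟨Sum.inr l, hl⟩ then t else 0 := by
      ext _ ⟨k, hk⟩
      rcases k with k | k
      · simp [extMat]
      · by_cases hkl : k = l <;> simp [extMat, x, hkl]
    have e2 : (Matrix.of fun (k : K) (_ : Unit) => extMat Γ (x t) k (Sum.inl j))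
        = Matrix.of fun (k : K) (_ : Unit) => extMat Γ (fun _ => 0) (k : Nt ⊕ Lt) (Sum.inl j) +
          if k = ⟨Sum.inr l, hl⟩ then 1 else 0 := by
      ext ⟨k, hk⟩ _
      rcases k with k | k
      · simp [extMat]
      · by_cases hkl : k = l <;> simp [extMat, x, hkl, hij'.symm]
    rw [e1, e2]
    exact ht

lemma extMat_eval {Nt Lt R : Type*} [CommRing R] (Γ : Matrix Nt Nt R)
    (x : Sym2 (Nt ⊕ Lt) → R) :
    (extMat (Γ.map MvPolynomial.C) (MvPolynomial.X : Sym2 (Nt ⊕ Lt) → MvPolynomial _ R)).map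
      (MvPolynomial.eval x) = extMat Γ x := by
  ext a b
  rcases a with a | a <;> rcases b with b | b <;> simp [extMat]

lemma exists_generic {Nt Lt R : Type*} [Fintype Nt] [Fintype Lt] [DecidableEq Nt] [DecidableEq Lt]
    [Field R] (Γ : Matrix Nt Nt R) (hΓ : PrinReg Γ) (s : Sym2 (Nt ⊕ Lt) → Set R)
    (hs : ∀ e, (s e).Infinite) :
    ∃ x : Sym2 (Nt ⊕ Lt) → R, (∀ e, x e ∈ s e) ∧ PrinReg (extMat Γ x) ∧
      ∀ i j K, BadStmt i j K → apminor (extMat Γ x) i j K ≠ 0 := by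
  classical
  let P := extMat (Γ.map MvPolynomial.C) (MvPolynomial.X : Sym2 (Nt ⊕ Lt) → MvPolynomial _ R)
  let Q : MvPolynomial (Sym2 (Nt ⊕ Lt)) R := (∏ S : Finset (Nt ⊕ Lt), pminor P S) *
    ∏ q : (Nt ⊕ Lt) × (Nt ⊕ Lt) × Finset (Nt ⊕ Lt),
      if BadStmt q.1 q.2.1 q.2.2 then apminor P q.1 q.2.1 q.2.2 else 1
  have hQ : Q ≠ 0 := by
    refine mul_ne_zero (Finset.prod_ne_zero_iff.mpr ?_) (Finset.prod_ne_zero_iff.mpr ?_)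
    · intro S _ h0
      let x : Sym2 (Nt ⊕ Lt) → R := fun e => if e.IsDiag then 1 else 0
      have h := congrArg (MvPolynomial.eval x) h0
      rw [pminor_map, extMat_eval, map_zero] at h
      refine pminor_ext_ne Γ hΓ x S ?_ ?_ h
      · intro a _; simp [x]
      · intro a _ b _ hab; simp [x, hab]
    · rintro ⟨i, j, K⟩ _
      dsimp only
      split_ifs with hb
      · intro h0
        obtain ⟨x, hx⟩ := exists_apminor_ne Γ hΓ i j K hb
        have h := congrArg (MvPolynomial.eval x) h0
        rw [apminor_map, extMat_eval, map_zero] at h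
        exact hx h
      · exact one_ne_zero
  obtain ⟨x, hx, hxQ⟩ : ∃ x ∈ Set.pi Set.univ s, MvPolynomial.eval x Q ≠ 0 := by
    by_contra! hcon
    exact hQ (MvPolynomial.funext_set s hs (fun x hx => by rw [hcon x hx, map_zero]))
  refine ⟨x, fun e => hx e (Set.mem_univ _), ?_, ?_⟩
  · intro S
    have h := left_ne_zero_of_mul (by simpa only [Q, map_mul] using hxQ)
    rw [map_prod] at h
    have h := Finset.prod_ne_zero_iff.mp h S (Finset.mem_univ _)
    rwa [pminor_map, extMat_eval] at h
  · intro i j K hb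
    have h := right_ne_zero_of_mul (by simpa only [Q, map_mul] using hxQ)
    rw [map_prod] at h
    have h := Finset.prod_ne_zero_iff.mp h (i, j, K) (Finset.mem_univ _)
    simp only [if_pos hb] at h
    rwa [apminor_map, extMat_eval] at h

lemma cis_extMat {Nt Lt R : Type*} [DecidableEq Nt] [DecidableEq Lt]
    [Field R] (Γ : Matrix Nt Nt R) (x : Sym2 (Nt ⊕ Lt) → R)
    (h : ∀ i j K, BadStmt i j K → apminor (extMat Γ x) i j K ≠ 0) :
    CIS (extMat Γ x) = embedCI (CIS Γ) := by
  ext ⟨e, K⟩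
  constructor
  · rintro ⟨⟨hd, hK⟩, h0⟩
    induction e with
    | _ i j =>
    have hij : i ≠ j := by simpa using hd
    have hi : i ∉ K := hK i (by simp)
    have hj : j ∉ K := hK j (by simp)
    have hnb : ¬ BadStmt i j K := fun hb => h i j K hb (h0 i j rfl)
    have hnb' : ¬ (i.isRight ∨ j.isRight ∨ ∃ l : Lt, Sum.inr l ∈ K) :=
      fun hh => hnb ⟨hij, hi, hj, hh⟩
    rcases i with i | i
    swap
    · simp at hnb'
    rcases j with j | j
    swap
    · simp at hnb'
    have hKe : K = K.toLeft.map Function.Embedding.inl := by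
      ext k
      rcases k with k | k
      · simp
      · simp at hnb' ⊢
        exact hnb' k
    refine ⟨i, j, K.toLeft, ⟨⟨by simpa using hij, ?_⟩, ?_⟩, by rw [← hKe]⟩
    · intro k hk
      have hk' : k = i ∨ k = j := by simpa using hk
      rcases hk' with rfl | rfl <;> simpa
    · intro i' j' hij'
      rw [← apminor_inl Γ x, ← hKe]
      apply h0
      have := congrArg (Sym2.map (Sum.inl : Nt → Nt ⊕ Lt)) hij'
      simpa using this
  · rintro ⟨i, j, K', ⟨⟨hd, hK⟩, h0⟩, heq⟩
    rw [Prod.mk.injEq] at heq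
    obtain ⟨rfl, rfl⟩ := heq
    have hij : i ≠ j := by simpa using hd
    have hi : i ∉ K' := hK i (by simp)
    have hj : j ∉ K' := hK j (by simp)
    refine ⟨⟨by simpa using hij, ?_⟩, ?_⟩
    · intro k hk
      have hk' : k = Sum.inl i ∨ k = Sum.inl j := by simpa using hk
      rcases hk' with rfl | rfl <;> simpa
    · intro i' j' hij'
      have hij'' : (Sum.inl i = i' ∧ Sum.inl j = j') ∨ (Sum.inl i = j' ∧ Sum.inl j = i') := by
        simpa using hij'
      rcases hij'' with ⟨rfl, rfl⟩ | ⟨rfl, rfl⟩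
      · exact (apminor_inl Γ x i j K').trans (h0 i j rfl)
      · exact (apminor_inl Γ x j i K').trans (h0 j i Sym2.eq_swap)

universe u v w

/-- a CI structure algebraically realizable on `Nt` remains algebraically
realizable after embedding the ground set into `Nt ⊕ Lt`; over an ordered field the
realization can be chosen close to a block-diagonal matrix with arbitrary principally
regular second block. -/
theorem stmt8 :
    (∀ (𝕂 : Type u) [Field 𝕂] [Infinite 𝕂],
     ∀ (Nt : Type v) (Lt : Type w) [Fintype Nt] [DecidableEq Nt] [Fintype Lt] [DecidableEq Lt]
       (Γ : Matrix Nt Nt 𝕂), Γ.IsSymm → PrinReg Γ →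
       ∃ Φ : Matrix (Nt ⊕ Lt) (Nt ⊕ Lt) 𝕂,
         Φ.IsSymm ∧ PrinReg Φ ∧ CIS Φ = embedCI (CIS Γ)) ∧
    (∀ (𝕂 : Type u) [Field 𝕂] [LinearOrder 𝕂] [IsStrictOrderedRing 𝕂],
     ∀ (Nt : Type v) (Lt : Type w) [Fintype Nt] [DecidableEq Nt] [Fintype Lt] [DecidableEq Lt]
       (Γ : Matrix Nt Nt 𝕂) (Λ : Matrix Lt Lt 𝕂),
       Γ.IsSymm → PrinReg Γ → Λ.IsSymm → PrinReg Λ →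
       ∀ ε : 𝕂, 0 < ε →
         ∃ Φ : Matrix (Nt ⊕ Lt) (Nt ⊕ Lt) 𝕂,
           Φ.IsSymm ∧ PrinReg Φ ∧ CIS Φ = embedCI (CIS Γ) ∧
           ∀ a b : Nt ⊕ Lt, |Φ a b - Matrix.fromBlocks Γ 0 0 Λ a b| < ε) := by
  refine ⟨?_, ?_⟩
  · intro 𝕂 _ _ Nt Lt _ _ _ _ Γ hs hΓ
    obtain ⟨x, -, h1, h2⟩ := exists_generic (Lt := Lt) Γ hΓ (fun _ => Set.univ)
      (fun _ => Set.infinite_univ)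
    exact ⟨extMat Γ x, extMat_symm Γ hs x, h1, cis_extMat Γ x h2⟩
  · intro 𝕂 _ _ _ Nt Lt _ _ _ _ Γ Λ hs hΓ hΛ _ ε hε
    have hB : (Matrix.fromBlocks Γ 0 0 Λ).IsSymm :=
      Matrix.IsSymm.fromBlocks hs (by simp) hΛ
    let B : Sym2 (Nt ⊕ Lt) → 𝕂 := Sym2.lift ⟨fun a b => Matrix.fromBlocks Γ 0 0 Λ a b,
      fun a b => (hB.apply a b).symm⟩
    obtain ⟨x, hx, h1, h2⟩ := exists_generic (Lt := Lt) Γ hΓ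
      (fun e => Set.Ioo (B e - ε) (B e + ε))
      (fun e => Set.Ioo_infinite (by linarith))
    refine ⟨extMat Γ x, extMat_symm Γ hs x, h1, cis_extMat Γ x h2, ?_⟩
    intro a b
    have hab : |x s(a, b) - Matrix.fromBlocks Γ 0 0 Λ a b| < ε := by
      have := hx s(a, b)
      simp only [B, Sym2.lift_mk, Set.mem_Ioo] at this
      rw [abs_lt]
      constructor <;> linarith [this.1, this.2]
    rcases a with a | a <;> rcases b with b | b
    · simpa [extMat] using hε
    all_goals exact hab
end
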